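/- arXiv:0911.2659 — 8 statements merged into one kernel-verified Lean document; each statement's English description precedes it below -/
import Mathlib

section
/- There is a homomorphism of S-algebras ρ : Cliff_S(q_φ) → End_S(M) with ρ(λ) = ∂_λ for all λ ∈ (S^m)^∨ and ρ(g) = θ_g for all g ∈ S^n. In particular, as operators on M one has ∂_λ∂_μ + ∂_μ∂_λ = 0, θ_gθ_h + θ_hθ_g = 0, and ∂_{λ_i}θ_{g_j} + θ_{g_j}∂_{λ_i} = x_{ij}·id_M for all 1 ≤ i ≤ m, 1 ≤ j ≤ n. -/
/-!
STATEMENT 3: With `K` a field, `m ≤ n` positive integers, `S = K[x_{ij}]`, `φ : S^n → S^m` the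
generic map and `M = ⊕_{a=1}^m M_a` where `M_a = coker(Λ^a φ)`: there is an `S`-algebra
homomorphism `ρ : Cliff_S(q_φ) → End_S(M)` with `ρ(λ) = ∂_λ` for `λ ∈ (S^m)^∨` and
`ρ(g) = θ_g` for `g ∈ S^n`.  In particular `∂_λ∂_μ + ∂_μ∂_λ = 0`, `θ_gθ_h + θ_hθ_g = 0` and
`∂_{λ_i}θ_{g_j} + θ_{g_j}∂_{λ_i} = x_{ij}·id_M`.

Here `q_φ` is the quadratic form `q_φ(λ ⊕ g) = λ(φ(g))` on `(S^m)^∨ ⊕ S^n`, `∂_λ` is the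
`S`-endomorphism of `M` induced by left contraction with `λ` on `Λ S^m` (which is well defined
because contraction with `λ∘φ` on `Λ S^n` is compatible), and `θ_g` is the endomorphism induced
by exterior left multiplication with `φ(g)` on `Λ S^m` (compatible with multiplication by `g` on
`Λ S^n`).  We realize `M` as `Λ S^m / image(Λ φ)`, whose degree-`a` component is `M_a`
(the degree-`0` component being trivial), and the existence assertion for `∂_λ`, `θ_g`
includes their well-definedness: they are the (unique) operators descending contraction
resp. multiplication along the projection `π : Λ S^m → M`.
-/

noncomputable section

variable (K : Type) [Field K] (m n : ℕ)

/-- `S = K[x_{ij}]`. -/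
abbrev detS (K : Type) [Field K] (m n : ℕ) : Type := MvPolynomial (Fin m × Fin n) K

/-- The generic matrix `X`. -/
def genX (K : Type) [Field K] (m n : ℕ) : Matrix (Fin m) (Fin n) (detS K m n) :=
  fun i j => MvPolynomial.X (i, j)

/-- The generic map `φ : S^n → S^m`. -/
def genφ (K : Type) [Field K] (m n : ℕ) :
    (Fin n → detS K m n) →ₗ[detS K m n] (Fin m → detS K m n) :=
  Matrix.toLin' (genX K m n)

/-- `M = Λ S^m / image(Λ φ) = ⊕_{a=1}^m coker(Λ^a φ)`. -/
abbrev detM (K : Type) [Field K] (m n : ℕ) : Type :=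
  ExteriorAlgebra (detS K m n) (Fin m → detS K m n) ⧸
    LinearMap.range (ExteriorAlgebra.map (genφ K m n)).toLinearMap

/-- The projection `π : Λ S^m → M`. -/
def detπ (K : Type) [Field K] (m n : ℕ) :
    ExteriorAlgebra (detS K m n) (Fin m → detS K m n) →ₗ[detS K m n] detM K m n :=
  Submodule.mkQ _

/-- The bilinear form `(λ ⊕ g, λ' ⊕ g') ↦ λ(φ(g'))` on `(S^m)^∨ ⊕ S^n`. -/
def qφBilin (K : Type) [Field K] (m n : ℕ) :
    (Module.Dual (detS K m n) (Fin m → detS K m n) × (Fin n → detS K m n)) →ₗ[detS K m n]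
    (Module.Dual (detS K m n) (Fin m → detS K m n) × (Fin n → detS K m n)) →ₗ[detS K m n]
      detS K m n :=
  LinearMap.mk₂ (detS K m n) (fun p q => p.1 (genφ K m n q.2))
    (fun p p' q => by simp)
    (fun c p q => by simp)
    (fun p q q' => by simp)
    (fun c p q => by simp)

/-- The quadratic form `q_φ(λ ⊕ g) = λ(φ(g))`. -/
def qφ (K : Type) [Field K] (m n : ℕ) :
    QuadraticForm (detS K m n)
      (Module.Dual (detS K m n) (Fin m → detS K m n) × (Fin n → detS K m n)) :=
  LinearMap.BilinMap.toQuadraticMap (qφBilin K m n)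

/-- Left contraction with `λ` on the exterior algebra `Λ S^m`. -/
def ctr (lam : Module.Dual (detS K m n) (Fin m → detS K m n)) :
    ExteriorAlgebra (detS K m n) (Fin m → detS K m n) →ₗ[detS K m n]
      ExteriorAlgebra (detS K m n) (Fin m → detS K m n) :=
  CliffordAlgebra.contractLeft (Q := (0 : QuadraticForm (detS K m n) (Fin m → detS K m n))) lam

namespace ExteriorAlgebra

variable {R N P : Type*} [CommRing R] [AddCommGroup N] [Module R N] [AddCommGroup P] [Module R P]

theorem contractLeft_map (f : N →ₗ[R] P) (d : Module.Dual R P) (x : ExteriorAlgebra R N) :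
    CliffordAlgebra.contractLeft (Q := (0 : QuadraticForm R P)) d (map f x) =
      map f (CliffordAlgebra.contractLeft (Q := (0 : QuadraticForm R N)) (d ∘ₗ f) x) := by
  induction x using CliffordAlgebra.left_induction with
  | algebraMap r =>
    rw [AlgHom.commutes, CliffordAlgebra.contractLeft_algebraMap,
      CliffordAlgebra.contractLeft_algebraMap, map_zero]
  | add x y hx hy => simp only [map_add, hx, hy]
  | ι_mul x v hx =>
    have hv : map f (CliffordAlgebra.ι (0 : QuadraticForm R N) v) =
        CliffordAlgebra.ι (0 : QuadraticForm R P) (f v) := map_apply_ι f v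
    rw [map_mul, hv, CliffordAlgebra.contractLeft_ι_mul, CliffordAlgebra.contractLeft_ι_mul,
      hx, map_sub, map_smul, map_mul, hv, LinearMap.comp_apply]

/-- The cokernel of `Λ f : Λ N → Λ P`. -/
abbrev MapCoker (f : N →ₗ[R] P) : Type _ :=
  ExteriorAlgebra R P ⧸ LinearMap.range (map f).toLinearMap

/-- The endomorphism of `coker (Λ f)` induced by left contraction with `d`. -/
def cokerContract (f : N →ₗ[R] P) : Module.Dual R P →ₗ[R] Module.End R (MapCoker f) where
  toFun d := Submodule.mapQ _ _
    (CliffordAlgebra.contractLeft (Q := (0 : QuadraticForm R P)) d) <| by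
      rintro _ ⟨x, rfl⟩
      exact ⟨_, (contractLeft_map f d x).symm⟩
  map_add' d e := by
    refine Submodule.linearMap_qext _ (LinearMap.ext fun x => ?_)
    simp
  map_smul' c d := by
    refine Submodule.linearMap_qext _ (LinearMap.ext fun x => ?_)
    simp

/-- The endomorphism of `coker (Λ f)` induced by left multiplication with `f g`. -/
def cokerWedge (f : N →ₗ[R] P) : N →ₗ[R] Module.End R (MapCoker f) where
  toFun g := Submodule.mapQ _ _ (LinearMap.mulLeft R (ι R (f g))) <| by
      rintro _ ⟨x, rfl⟩
      refine ⟨ι R g * x, ?_⟩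
      simp
  map_add' g h := by
    refine Submodule.linearMap_qext _ (LinearMap.ext fun x => ?_)
    simp [add_mul]
  map_smul' c g := by
    refine Submodule.linearMap_qext _ (LinearMap.ext fun x => ?_)
    simp

theorem cokerContract_mk (f : N →ₗ[R] P) (d : Module.Dual R P) (x : ExteriorAlgebra R P) :
    cokerContract f d (Submodule.Quotient.mk x) = Submodule.Quotient.mk
      (CliffordAlgebra.contractLeft (Q := (0 : QuadraticForm R P)) d x) := rfl

theorem cokerWedge_mk (f : N →ₗ[R] P) (g : N) (x : ExteriorAlgebra R P) :
    cokerWedge f g (Submodule.Quotient.mk x) = Submodule.Quotient.mk (ι R (f g) * x) := rfl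

theorem cokerContract_mul_self (f : N →ₗ[R] P) (d : Module.Dual R P) :
    cokerContract f d * cokerContract f d = 0 := by
  refine Submodule.linearMap_qext _ (LinearMap.ext fun x => ?_)
  change cokerContract f d (cokerContract f d (Submodule.Quotient.mk x)) = 0
  rw [cokerContract_mk, cokerContract_mk, CliffordAlgebra.contractLeft_contractLeft,
    Submodule.Quotient.mk_zero]

theorem cokerContract_anticomm (f : N →ₗ[R] P) (d e : Module.Dual R P) :
    cokerContract f d * cokerContract f e + cokerContract f e * cokerContract f d = 0 := by
  have h := cokerContract_mul_self f (d + e)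
  rwa [map_add, add_mul, mul_add, mul_add, cokerContract_mul_self, cokerContract_mul_self,
    zero_add, add_zero] at h

theorem cokerWedge_mul_self (f : N →ₗ[R] P) (g : N) :
    cokerWedge f g * cokerWedge f g = 0 := by
  refine Submodule.linearMap_qext _ (LinearMap.ext fun x => ?_)
  change cokerWedge f g (cokerWedge f g (Submodule.Quotient.mk x)) = 0
  rw [cokerWedge_mk, cokerWedge_mk, ← mul_assoc, ι_sq_zero, zero_mul, Submodule.Quotient.mk_zero]

theorem cokerWedge_anticomm (f : N →ₗ[R] P) (g h : N) :
    cokerWedge f g * cokerWedge f h + cokerWedge f h * cokerWedge f g = 0 := by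
  have H := cokerWedge_mul_self f (g + h)
  rwa [map_add, add_mul, mul_add, mul_add, cokerWedge_mul_self, cokerWedge_mul_self,
    zero_add, add_zero] at H

theorem cokerContract_mul_cokerWedge_add (f : N →ₗ[R] P) (d : Module.Dual R P) (g : N) :
    cokerContract f d * cokerWedge f g + cokerWedge f g * cokerContract f d =
      d (f g) • (1 : Module.End R (MapCoker f)) := by
  refine Submodule.linearMap_qext _ (LinearMap.ext fun x => ?_)
  change cokerContract f d (cokerWedge f g (Submodule.Quotient.mk x)) +
    cokerWedge f g (cokerContract f d (Submodule.Quotient.mk x)) =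
      d (f g) • Submodule.Quotient.mk x
  have h : CliffordAlgebra.contractLeft (Q := (0 : QuadraticForm R P)) d (ι R (f g) * x) =
      d (f g) • x - ι R (f g) * CliffordAlgebra.contractLeft (Q := (0 : QuadraticForm R P)) d x :=
    CliffordAlgebra.contractLeft_ι_mul d (f g) x
  rw [cokerWedge_mk, cokerContract_mk, cokerContract_mk, cokerWedge_mk, h,
    ← Submodule.Quotient.mk_add, sub_add_cancel, Submodule.Quotient.mk_smul]

theorem cokerContract_add_cokerWedge_mul_self (f : N →ₗ[R] P) (d : Module.Dual R P) (g : N) :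
    (cokerContract f d + cokerWedge f g) * (cokerContract f d + cokerWedge f g) =
      algebraMap R (Module.End R (MapCoker f)) (d (f g)) := by
  rw [add_mul, mul_add, mul_add, cokerContract_mul_self, cokerWedge_mul_self, zero_add, add_zero,
    cokerContract_mul_cokerWedge_add, Algebra.algebraMap_eq_smul_one]

theorem exists_cliffordAlgebra_hom (f : N →ₗ[R] P) (Q : QuadraticForm R (Module.Dual R P × N))
    (hQ : ∀ p, Q p = p.1 (f p.2)) :
    ∃ ρ : CliffordAlgebra Q →ₐ[R] Module.End R (MapCoker f),
      (∀ d, ρ (CliffordAlgebra.ι Q (d, 0)) = cokerContract f d) ∧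
      ∀ g, ρ (CliffordAlgebra.ι Q (0, g)) = cokerWedge f g := by
  have h (p : Module.Dual R P × N) : (cokerContract f).coprod (cokerWedge f) p *
      (cokerContract f).coprod (cokerWedge f) p = algebraMap R _ (Q p) := by
    rw [hQ, LinearMap.coprod_apply, cokerContract_add_cokerWedge_mul_self]
  refine ⟨CliffordAlgebra.lift Q ⟨_, h⟩, fun d => ?_, fun g => ?_⟩
  · rw [CliffordAlgebra.lift_ι_apply, LinearMap.coprod_apply, map_zero, add_zero]
  · rw [CliffordAlgebra.lift_ι_apply, LinearMap.coprod_apply, map_zero, zero_add]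

end ExteriorAlgebra

theorem clifford_action_on_M (hm : 0 < m) (hmn : m ≤ n) :
    ∃ (D : Module.Dual (detS K m n) (Fin m → detS K m n) → Module.End (detS K m n) (detM K m n))
      (T : (Fin n → detS K m n) → Module.End (detS K m n) (detM K m n)),
      -- `∂_λ` is induced by left contraction with `λ` on `Λ S^m`:
      (∀ lam x, D lam (detπ K m n x) = detπ K m n (ctr K m n lam x)) ∧
      -- `θ_g` is induced by exterior left multiplication with `φ(g)` on `Λ S^m`:
      (∀ g x, T g (detπ K m n x) =
        detπ K m n (ExteriorAlgebra.ι (detS K m n) (genφ K m n g) * x)) ∧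
      -- the Clifford relations hold for these operators:
      (∀ lam mu, D lam * D mu + D mu * D lam = 0) ∧
      (∀ g h, T g * T h + T h * T g = 0) ∧
      (∀ (i : Fin m) (j : Fin n),
        D (LinearMap.proj i) * T (Pi.single j 1) + T (Pi.single j 1) * D (LinearMap.proj i)
          = genX K m n i j • (1 : Module.End (detS K m n) (detM K m n))) ∧
      -- and there is an `S`-algebra homomorphism `ρ : Cliff_S(q_φ) → End_S(M)` with
      -- `ρ(λ) = ∂_λ` and `ρ(g) = θ_g`:
      ∃ ρ : CliffordAlgebra (qφ K m n) →ₐ[detS K m n] Module.End (detS K m n) (detM K m n),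
        (∀ lam, ρ (CliffordAlgebra.ι (qφ K m n) (lam, 0)) = D lam) ∧
        (∀ g, ρ (CliffordAlgebra.ι (qφ K m n) (0, g)) = T g) := by
  refine ⟨ExteriorAlgebra.cokerContract (genφ K m n), ExteriorAlgebra.cokerWedge (genφ K m n),
    fun _ _ => rfl, fun _ _ => rfl, ExteriorAlgebra.cokerContract_anticomm _,
    ExteriorAlgebra.cokerWedge_anticomm _, fun i j => ?_, ?_⟩
  · have h : genX K m n i j = (LinearMap.proj i : Module.Dual (detS K m n) (Fin m → detS K m n))
        (genφ K m n (Pi.single j 1)) := by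
      simp [genφ]
    rw [h]
    exact ExteriorAlgebra.cokerContract_mul_cokerWedge_add _ _ _
  · exact ExteriorAlgebra.exists_cliffordAlgebra_hom _ _ fun _ => rfl

end
end

section
/- Let t ≥ 1 and u ≥ 2t be integers, and let A be the t×t matrix over ℚ with entries A_{ij} = 1/(u−i−j)! for 1 ≤ i, j ≤ t (note u−i−j ≥ u−2t ≥ 0, so the factorial is defined). Then det A ≠ 0. -/
/-!
STATEMENT 8: Let `t ≥ 1` and `u ≥ 2t` be integers, and let `A` be the `t × t` matrix over `ℚ`
with entries `A i j = 1/(u−i−j)!` for `1 ≤ i, j ≤ t` (indices `i, j ∈ Fin t` correspond to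
`i.1+1, j.1+1 ∈ {1, …, t}`).  Then `det A ≠ 0`.
-/
theorem factorial_matrix_det_ne_zero (t u : ℕ) (ht : 1 ≤ t) (hu : 2 * t ≤ u)
    (A : Matrix (Fin t) (Fin t) ℚ)
    (hA : ∀ i j : Fin t, A i j = 1 / (Nat.factorial (u - (i.1 + 1) - (j.1 + 1)) : ℚ)) :
    A.det ≠ 0 := by
  have hm (i j : Fin t) : j.1 ≤ u - 2 - i.1 := by omega
  let v : Fin t → ℚ := fun i => ((u - 2 - i.1 : ℕ) : ℚ)
  let c : Fin t → ℚ := fun i => ((u - 2 - i.1).factorial : ℚ)⁻¹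
  have hv : Function.Injective v := fun i j h => by
    have h' : u - 2 - i.1 = u - 2 - j.1 := Nat.cast_injective h
    exact Fin.ext (by omega)
  have hfac : A = Matrix.of fun i j => c i *
      (Matrix.of fun i j : Fin t => (descPochhammer ℚ j).eval (v i)) i j := by
    ext i j
    have hsub : u - (i.1 + 1) - (j.1 + 1) = u - 2 - i.1 - j.1 := by omega
    have hfact : ((u - 2 - i.1 - j.1).factorial : ℚ) * (u - 2 - i.1).descFactorial j =
        (u - 2 - i.1).factorial := mod_cast Nat.factorial_mul_descFactorial (hm i j)
    simp only [hA, hsub, Matrix.of_apply, c, v, descPochhammer_eval_eq_descFactorial]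
    rw [← hfact]
    have := Nat.factorial_ne_zero (u - 2 - i.1 - j.1)
    have := (Nat.descFactorial_pos.2 (hm i j)).ne'
    field_simp
  rw [hfac, Matrix.det_mul_column,
    ← Matrix.det_eval_matrixOfPolynomials_eq_det_vandermonde v
      (fun j => descPochhammer ℚ j) (fun j => descPochhammer_natDegree ℚ j)
      (fun j => monic_descPochhammer ℚ j)]
  exact mul_ne_zero
    (Finset.prod_ne_zero_iff.2 fun i _ => inv_ne_zero (mod_cast Nat.factorial_ne_zero _))
    (Matrix.det_vandermonde_ne_zero_iff.2 hv)
end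

section
/- Let t ≥ 1 and u ≥ 2t be integers, and let A be the t×t matrix over ℚ with entries A_{ij} = 1/(u−i−j)! for 1 ≤ i, j ≤ t. Then there exist a t×t diagonal matrix D over ℚ with all diagonal entries nonzero and a t×t upper triangular matrix P over ℚ with all diagonal entries equal to 1 such that A = P·D·Pᵀ. -/
/-- The matrix with entries `1 / (m - i - j)!` is nonsingular as soon as no subtraction
truncates. -/
theorem det_inv_factorial_ne_zero (t m : ℕ) (hm : 2 * t ≤ m + 2) :
    (Matrix.of fun i j : Fin t => 1 / (Nat.factorial (m - i.1 - j.1) : ℚ)).det ≠ 0 := by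
  set B : Matrix (Fin t) (Fin t) ℚ :=
    Matrix.of fun i j => 1 / (Nat.factorial (m - i.1 - j.1) : ℚ) with hB
  have hv : (Matrix.of fun i j : Fin t =>
      ((descPochhammer ℚ j.1).eval (((m - i.1 : ℕ)) : ℚ))).det ≠ 0 := by
    rw [← Matrix.det_eval_matrixOfPolynomials_eq_det_vandermonde
      (fun i : Fin t => (((m - i.1 : ℕ)) : ℚ)) (fun j : Fin t => descPochhammer ℚ j.1)
      (fun j => descPochhammer_natDegree ℚ j) (fun j => monic_descPochhammer ℚ j),
      Matrix.det_vandermonde_ne_zero_iff]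
    intro i j hij
    have : m - i.1 = m - j.1 := by exact Nat.cast_injective (R := ℚ) hij
    ext
    omega
  have hrow : (Matrix.of fun i j : Fin t =>
      ((descPochhammer ℚ j.1).eval (((m - i.1 : ℕ)) : ℚ))) =
      Matrix.of fun i j : Fin t => (Nat.factorial (m - i.1) : ℚ) * B i j := by
    ext i j
    have hle : j.1 ≤ m - i.1 := by omega
    have hfac := Nat.factorial_mul_descFactorial hle
    have hne : (Nat.factorial (m - i.1 - j.1) : ℚ) ≠ 0 := by positivity
    simp only [Matrix.of_apply, hB, descPochhammer_eval_eq_descFactorial]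
    rw [← hfac]
    push_cast
    field_simp
  rw [hrow, Matrix.det_mul_column] at hv
  exact right_ne_zero_of_mul hv

/-- The determinant of `P * diagonal d * Pᵀ` for `P` upper unitriangular. -/
theorem det_unitriangular_mul_diagonal_mul_transpose {K : Type*} [CommRing K] {n : ℕ}
    {P : Matrix (Fin n) (Fin n) K} (d : Fin n → K) (hP : P.BlockTriangular id)
    (hP1 : ∀ i, P i i = 1) :
    (P * Matrix.diagonal d * P.transpose).det = ∏ i, d i := by
  simp [Matrix.det_mul, Matrix.det_transpose, Matrix.det_of_isUpperTriangular hP, hP1]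

/-- A factorization `P * diagonal d * Pᵀ` of the trailing block of a symmetric matrix extends to
the whole matrix when the trailing block is nonsingular. -/
theorem exists_unitriangular_diagonal_succ {K : Type*} [Field K] {n : ℕ}
    {A : Matrix (Fin (n + 1)) (Fin (n + 1)) K} (hA : A.IsSymm)
    {d : Fin n → K} {P : Matrix (Fin n) (Fin n) K} (hd : ∀ i, d i ≠ 0)
    (hP : P.BlockTriangular id) (hP1 : ∀ i, P i i = 1)
    (h : A.submatrix Fin.succ Fin.succ = P * Matrix.diagonal d * P.transpose) :
    ∃ (d' : Fin (n + 1) → K) (P' : Matrix (Fin (n + 1)) (Fin (n + 1)) K),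
      P'.BlockTriangular id ∧ (∀ i, P' i i = 1) ∧
      A = P' * Matrix.diagonal d' * P'.transpose := by
  have hunit : IsUnit (P * Matrix.diagonal d).det := by
    simp [Matrix.det_mul, Matrix.det_of_isUpperTriangular hP, hP1, Finset.prod_ne_zero_iff, hd]
  obtain ⟨x, hx⟩ : ∃ x : Fin n → K,
      (P * Matrix.diagonal d).mulVec x = fun i => A i.succ 0 :=
    ⟨(P * Matrix.diagonal d)⁻¹.mulVec fun i => A i.succ 0, by
      rw [Matrix.mulVec_mulVec, Matrix.mul_nonsing_inv _ hunit, Matrix.one_mulVec]⟩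
  have hx' (i : Fin n) : ∑ k, P i k * d k * x k = A i.succ 0 := by
    simpa [Matrix.mulVec, dotProduct, Matrix.mul_diagonal] using congrFun hx i
  refine ⟨Fin.cons (A 0 0 - ∑ k, x k * d k * x k) d,
    Matrix.of (Fin.cons (Fin.cons 1 x) fun i => Fin.cons 0 (P i)), ?_, ?_, ?_⟩
  · intro i j hij
    cases i using Fin.cases with
    | zero => exact absurd hij (Fin.not_lt_zero j)
    | succ i =>
      cases j using Fin.cases with
      | zero => simp
      | succ j => simpa using hP (Fin.succ_lt_succ_iff.mp hij)
  · intro i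
    cases i using Fin.cases <;> simp [hP1]
  · ext i j
    rw [Matrix.mul_apply, Fin.sum_univ_succ]
    simp only [Matrix.mul_diagonal]
    cases i using Fin.cases with
    | zero =>
      cases j using Fin.cases with
      | zero => simp
      | succ j =>
        rw [← hA.apply, ← hx']
        simp [mul_comm, mul_left_comm]
    | succ i =>
      cases j using Fin.cases with
      | zero => simp [hx']
      | succ j =>
        have := congrFun (congrFun h i) j
        rw [Matrix.mul_apply] at this
        simpa [Matrix.mul_diagonal] using this

/-- The matrix with entries `1 / (m - i - j)!` factors as `P * diagonal d * Pᵀ` with `P` upper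
unitriangular and all `d i` nonzero. -/
theorem exists_unitriangular_diagonal_inv_factorial (t m : ℕ) (hm : 2 * t ≤ m + 2) :
    ∃ (d : Fin t → ℚ) (P : Matrix (Fin t) (Fin t) ℚ),
      (∀ i, d i ≠ 0) ∧ P.BlockTriangular id ∧ (∀ i, P i i = 1) ∧
      (Matrix.of fun i j : Fin t => 1 / (Nat.factorial (m - i.1 - j.1) : ℚ)) =
        P * Matrix.diagonal d * P.transpose := by
  induction t generalizing m with
  | zero => exact ⟨0, 1, fun i => i.elim0, fun i => i.elim0, fun i => i.elim0,
      Matrix.ext fun i => i.elim0⟩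
  | succ t ih =>
    obtain ⟨d, P, hd, hP, hP1, h⟩ := ih (m - 2) (by omega)
    obtain ⟨d', P', hP', hP1', h'⟩ := exists_unitriangular_diagonal_succ
      (A := Matrix.of fun i j : Fin (t + 1) => 1 / (Nat.factorial (m - i.1 - j.1) : ℚ))
      (Matrix.IsSymm.ext fun i j => by simp [Nat.sub_right_comm]) hd hP hP1 (by
        rw [← h]
        ext i j
        have : m - (i.1 + 1) - (j.1 + 1) = m - 2 - i.1 - j.1 := by omega
        simp [this])
    refine ⟨d', P', fun i => ?_, hP', hP1', h'⟩
    have hdet := det_inv_factorial_ne_zero (t + 1) m hm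
    rw [h', det_unitriangular_mul_diagonal_mul_transpose d' hP' hP1'] at hdet
    exact Finset.prod_ne_zero_iff.mp hdet i (Finset.mem_univ i)

/-!
STATEMENT 9: Let `t ≥ 1` and `u ≥ 2t` be integers, and let `A` be the `t × t` matrix over `ℚ`
with entries `A i j = 1/(u−i−j)!` for `1 ≤ i, j ≤ t`.  Then `A = P * D * Pᵀ` for some diagonal
matrix `D` with nonzero diagonal entries and some upper triangular matrix `P` with unit diagonal.
-/
theorem factorial_matrix_diagonalization (t u : ℕ) (ht : 1 ≤ t) (hu : 2 * t ≤ u)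
    (A : Matrix (Fin t) (Fin t) ℚ)
    (hA : ∀ i j : Fin t, A i j = 1 / (Nat.factorial (u - (i.1 + 1) - (j.1 + 1)) : ℚ)) :
    ∃ D P : Matrix (Fin t) (Fin t) ℚ,
      (∀ i j : Fin t, i ≠ j → D i j = 0) ∧
      (∀ i : Fin t, D i i ≠ 0) ∧
      (∀ i j : Fin t, j < i → P i j = 0) ∧
      (∀ i : Fin t, P i i = 1) ∧
      A = P * D * P.transpose := by
  obtain ⟨d, P, hd, hP, hP1, h⟩ :=
    exists_unitriangular_diagonal_inv_factorial t (u - 2) (by omega)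
  refine ⟨Matrix.diagonal d, P, fun i j hij => Matrix.diagonal_apply_ne d hij, by simpa using hd,
    fun i j hij => hP hij, hP1, ?_⟩
  rw [← h]
  ext i j
  have : u - (i.1 + 1) - (j.1 + 1) = u - 2 - i.1 - j.1 := by omega
  simp [hA, this]
end

section
/- Let A be a commutative ring containing ℚ and let ψ_1,…,ψ_n, θ_1,…,θ_n be derivations of A which pairwise commute as additive endomorphisms of A and each of which is nilpotent. Then the binary operation on A defined by u * v = μ(exp(ψ_1⊗θ_1 + ⋯ + ψ_n⊗θ_n)(u ⊗ v)) is associative and has 1 as a two-sided unit; here μ : A ⊗_ℚ A → A is the multiplication map and exp(N) = Σ_{k≥0} N^k/k! is the (finite) exponential of the nilpotent operator N = Σ_i ψ_i⊗θ_i on A ⊗_ℚ A. -/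
/-!
STATEMENT 10: Let `A` be a commutative ring containing `ℚ` and let `ψ_1, …, ψ_n, θ_1, …, θ_n` be
derivations of `A` which pairwise commute (as additive endomorphisms) and are each nilpotent.
Then `u * v = μ(exp(ψ_1⊗θ_1 + ⋯ + ψ_n⊗θ_n)(u ⊗ v))` is an associative product on `A` with unit
`1`, where `μ : A ⊗[ℚ] A → A` is the multiplication and `exp` is the (finite) exponential of the
nilpotent operator `N = Σ ψ_i ⊗ θ_i` on `A ⊗[ℚ] A`.

(Derivations of `A` are automatically `ℚ`-linear, so they are taken as `ℚ`-linear maps with the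
Leibniz rule.  The conclusion asserts the nilpotency of `N`, i.e. `N ^ K = 0` for some `K`, and
that the product defined using the finite exponential `Σ_{k < K} N^k/k!` is associative and
unital.)
-/

open scoped TensorProduct

noncomputable section

variable (A : Type*) [CommRing A] [Algebra ℚ A]

/-- The operator `N = Σ_i ψ_i ⊗ θ_i` on `A ⊗[ℚ] A`. -/
def gsOperator {n : ℕ} (ψ θ : Fin n → (A →ₗ[ℚ] A)) :
    A ⊗[ℚ] A →ₗ[ℚ] A ⊗[ℚ] A :=
  ∑ i : Fin n, TensorProduct.map (ψ i) (θ i)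

/-- The Gerstenhaber–Schack star product `u * v = μ(exp(N)(u ⊗ v))`, where the exponential is
computed as the finite sum `Σ_{k < K} N^k / k!` (which is independent of `K` whenever
`N ^ K = 0`). -/
def gsStar {n : ℕ} (ψ θ : Fin n → (A →ₗ[ℚ] A)) (K : ℕ) (u v : A) : A :=
  LinearMap.mul' ℚ A
    ((∑ k ∈ Finset.range K, ((Nat.factorial k : ℚ))⁻¹ • (gsOperator A ψ θ) ^ k)
      (u ⊗ₜ[ℚ] v))

section Nilpotent

variable {M P : Type*} [AddCommGroup M] [Module ℚ M] [AddCommGroup P] [Module ℚ P] {n : ℕ}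

theorem commute_sum_tensorMap {f f' : Fin n → Module.End ℚ M} {g g' : Fin n → Module.End ℚ P}
    (hf : ∀ i j, Commute (f i) (f' j)) (hg : ∀ i j, Commute (g i) (g' j)) :
    Commute (∑ i, TensorProduct.map (f i) (g i) : Module.End ℚ (M ⊗[ℚ] P))
      (∑ i, TensorProduct.map (f' i) (g' i)) := by
  refine Commute.sum_left _ _ _ fun i _ ↦ Commute.sum_right _ _ _ fun j _ ↦ ?_
  rw [commute_iff_eq, ← TensorProduct.map_mul, ← TensorProduct.map_mul, (hf i j).eq, (hg i j).eq]

theorem isNilpotent_sum_tensorMap {f : Fin n → Module.End ℚ M} {g : Fin n → Module.End ℚ P}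
    (hf : ∀ i j, Commute (f i) (f j)) (hg : ∀ i j, Commute (g i) (g j))
    (hnil : ∀ i, IsNilpotent (f i)) :
    IsNilpotent (∑ i, TensorProduct.map (f i) (g i) : Module.End ℚ (M ⊗[ℚ] P)) := by
  refine Commute.isNilpotent_sum (fun i _ ↦ ?_) fun i j _ _ ↦ ?_
  · obtain ⟨k, hk⟩ := hnil i
    exact ⟨k, by rw [TensorProduct.map_pow, hk, TensorProduct.map_zero_left]⟩
  · rw [commute_iff_eq, ← TensorProduct.map_mul, ← TensorProduct.map_mul, (hf i j).eq,
      (hg i j).eq]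

end Nilpotent

section Star

open IsNilpotent Module.End

variable {A} {n : ℕ} {ψ θ : Fin n → (A →ₗ[ℚ] A)}

theorem gsStar_eq_exp {K : ℕ} (hK : gsOperator A ψ θ ^ K = 0) (u v : A) :
    gsStar A ψ θ K u v =
      LinearMap.mul' ℚ A (exp (gsOperator A ψ θ : Module.End ℚ (A ⊗[ℚ] A)) (u ⊗ₜ[ℚ] v)) := by
  rw [gsStar, exp_eq_sum hK]

theorem mul'_exp_gsOperator_one_tmul (hN : IsNilpotent (gsOperator A ψ θ))
    (hψ : ∀ i, ψ i 1 = 0) (u : A) :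
    LinearMap.mul' ℚ A (exp (gsOperator A ψ θ : Module.End ℚ (A ⊗[ℚ] A)) (1 ⊗ₜ[ℚ] u)) = u := by
  have h := commute_exp_left_of_commute (fM := (0 : Module.End ℚ A)) (fN := gsOperator A ψ θ)
    (g := TensorProduct.mk ℚ A A 1) IsNilpotent.zero hN (by ext; simp [gsOperator, hψ])
  simpa [exp_zero] using congrArg (LinearMap.mul' ℚ A) (LinearMap.congr_fun h u)

theorem mul'_exp_gsOperator_tmul_one (hN : IsNilpotent (gsOperator A ψ θ))
    (hθ : ∀ i, θ i 1 = 0) (u : A) :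
    LinearMap.mul' ℚ A (exp (gsOperator A ψ θ : Module.End ℚ (A ⊗[ℚ] A)) (u ⊗ₜ[ℚ] 1)) = u := by
  have h := commute_exp_left_of_commute (fM := (0 : Module.End ℚ A)) (fN := gsOperator A ψ θ)
    (g := (TensorProduct.mk ℚ A A).flip 1) IsNilpotent.zero hN (by ext; simp [gsOperator, hθ])
  simpa [exp_zero] using congrArg (LinearMap.mul' ℚ A) (LinearMap.congr_fun h u)

theorem isNilpotent_gsOperator (hψψ : ∀ i j, Commute (ψ i) (ψ j))
    (hθθ : ∀ i j, Commute (θ i) (θ j)) (hψnil : ∀ i, IsNilpotent (ψ i)) :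
    IsNilpotent (gsOperator A ψ θ : Module.End ℚ (A ⊗[ℚ] A)) :=
  isNilpotent_sum_tensorMap hψψ hθθ hψnil

variable (ψ θ) in
/-- The operator `N₁₂ + N₁₃` on `A ⊗ (A ⊗ A)`, to which `N` lifts along `id ⊗ μ`. -/
def gsOperatorRight : Module.End ℚ (A ⊗[ℚ] (A ⊗[ℚ] A)) :=
  ∑ i, TensorProduct.map (ψ i) ((θ i).rTensor A) + ∑ i, TensorProduct.map (ψ i) ((θ i).lTensor A)

variable (ψ θ) in
/-- The operator `N₁₃ + N₂₃` on `(A ⊗ A) ⊗ A`, to which `N` lifts along `μ ⊗ id`. -/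
def gsOperatorLeft : Module.End ℚ ((A ⊗[ℚ] A) ⊗[ℚ] A) :=
  ∑ i, TensorProduct.map ((ψ i).rTensor A) (θ i) + ∑ i, TensorProduct.map ((ψ i).lTensor A) (θ i)

theorem gsOperator_comp_lTensor_mul'
    (hθ : ∀ i, ∀ a b : A, θ i (a * b) = a * θ i b + θ i a * b) :
    gsOperator A ψ θ ∘ₗ (LinearMap.mul' ℚ A).lTensor A =
      (LinearMap.mul' ℚ A).lTensor A ∘ₗ gsOperatorRight ψ θ := by
  ext a b c
  simp [gsOperator, gsOperatorRight, hθ, TensorProduct.tmul_add, Finset.sum_add_distrib, add_comm]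

theorem gsOperator_comp_rTensor_mul'
    (hψ : ∀ i, ∀ a b : A, ψ i (a * b) = a * ψ i b + ψ i a * b) :
    gsOperator A ψ θ ∘ₗ (LinearMap.mul' ℚ A).rTensor A =
      (LinearMap.mul' ℚ A).rTensor A ∘ₗ gsOperatorLeft ψ θ := by
  ext a b c
  simp [gsOperator, gsOperatorLeft, hψ, TensorProduct.add_tmul, Finset.sum_add_distrib, add_comm]

theorem lTensor_gsOperator :
    (gsOperator A ψ θ).lTensor A =
      ∑ i, TensorProduct.map LinearMap.id (TensorProduct.map (ψ i) (θ i)) := by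
  ext a b c
  simp [gsOperator, TensorProduct.tmul_sum]

theorem rTensor_gsOperator :
    (gsOperator A ψ θ).rTensor A =
      ∑ i, TensorProduct.map (TensorProduct.map (ψ i) (θ i)) LinearMap.id := by
  ext a b c
  simp [gsOperator, TensorProduct.sum_tmul]

theorem assoc_comp_gsOperatorLeft_add :
    (gsOperatorRight ψ θ + (gsOperator A ψ θ).lTensor A) ∘ₗ
        (TensorProduct.assoc ℚ A A A).toLinearMap =
      (TensorProduct.assoc ℚ A A A).toLinearMap ∘ₗ
        (gsOperatorLeft ψ θ + (gsOperator A ψ θ).rTensor A) := by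
  ext a b c
  simp [lTensor_gsOperator, rTensor_gsOperator, gsOperatorLeft, gsOperatorRight]
  abel

theorem isNilpotent_gsOperatorRight (hψψ : ∀ i j, Commute (ψ i) (ψ j))
    (hθθ : ∀ i j, Commute (θ i) (θ j)) (hψnil : ∀ i, IsNilpotent (ψ i)) :
    IsNilpotent (gsOperatorRight ψ θ) := by
  have hr i j := (hθθ i j).map (Module.End.rTensorAlgHom ℚ A A)
  have hl i j := (hθθ i j).map (Module.End.lTensorAlgHom ℚ A A)
  refine Commute.isNilpotent_add (commute_sum_tensorMap hψψ fun i j ↦ ?_)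
    (isNilpotent_sum_tensorMap hψψ hr hψnil) (isNilpotent_sum_tensorMap hψψ hl hψnil)
  ext; simp

theorem isNilpotent_gsOperatorLeft (hψψ : ∀ i j, Commute (ψ i) (ψ j))
    (hθθ : ∀ i j, Commute (θ i) (θ j)) (hψnil : ∀ i, IsNilpotent (ψ i)) :
    IsNilpotent (gsOperatorLeft ψ θ) := by
  have hr i j := (hψψ i j).map (Module.End.rTensorAlgHom ℚ A A)
  have hl i j := (hψψ i j).map (Module.End.lTensorAlgHom ℚ A A)
  refine Commute.isNilpotent_add (commute_sum_tensorMap (fun i j ↦ ?_) hθθ)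
    (isNilpotent_sum_tensorMap hr hθθ fun i ↦ (hψnil i).map (Module.End.rTensorAlgHom ℚ A A))
    (isNilpotent_sum_tensorMap hl hθθ fun i ↦ (hψnil i).map (Module.End.lTensorAlgHom ℚ A A))
  ext; simp

theorem commute_gsOperatorRight_lTensor (hθθ : ∀ i j, Commute (θ i) (θ j))
    (hψθ : ∀ i j, Commute (ψ i) (θ j)) :
    Commute (gsOperatorRight ψ θ) ((gsOperator A ψ θ).lTensor A) := by
  rw [lTensor_gsOperator]
  refine Commute.add_left ?_ ?_ <;>
    refine commute_sum_tensorMap (fun i _ ↦ Commute.one_right (ψ i)) fun i j ↦ ?_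
  · ext x y
    simpa using congrArg (· ⊗ₜ[ℚ] θ j y) (LinearMap.congr_fun (hψθ j i).eq.symm x)
  · ext x y
    simpa using congrArg (ψ j x ⊗ₜ[ℚ] ·) (LinearMap.congr_fun (hθθ i j).eq y)

theorem commute_gsOperatorLeft_rTensor (hψψ : ∀ i j, Commute (ψ i) (ψ j))
    (hψθ : ∀ i j, Commute (ψ i) (θ j)) :
    Commute (gsOperatorLeft ψ θ) ((gsOperator A ψ θ).rTensor A) := by
  rw [rTensor_gsOperator]
  refine Commute.add_left ?_ ?_ <;>
    refine commute_sum_tensorMap (fun i j ↦ ?_) fun i _ ↦ Commute.one_right (θ i)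
  · ext x y
    simpa using congrArg (· ⊗ₜ[ℚ] θ j y) (LinearMap.congr_fun (hψψ i j).eq x)
  · ext x y
    simpa using congrArg (ψ j x ⊗ₜ[ℚ] ·) (LinearMap.congr_fun (hψθ i j).eq y)

theorem mul'_exp_gsOperator_assoc
    (hψLeibniz : ∀ i, ∀ a b : A, ψ i (a * b) = a * ψ i b + ψ i a * b)
    (hθLeibniz : ∀ i, ∀ a b : A, θ i (a * b) = a * θ i b + θ i a * b)
    (hψψ : ∀ i j, Commute (ψ i) (ψ j)) (hθθ : ∀ i j, Commute (θ i) (θ j))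
    (hψθ : ∀ i j, Commute (ψ i) (θ j)) (hψnil : ∀ i, IsNilpotent (ψ i)) (u v w : A) :
    let E : Module.End ℚ (A ⊗[ℚ] A) := exp (gsOperator A ψ θ)
    let m := LinearMap.mul' ℚ A
    m (E (m (E (u ⊗ₜ v)) ⊗ₜ w)) = m (E (u ⊗ₜ m (E (v ⊗ₜ w)))) := by
  intro E m
  have hN := isNilpotent_gsOperator hψψ hθθ hψnil
  have hR := isNilpotent_gsOperatorRight hψψ hθθ hψnil
  have hL := isNilpotent_gsOperatorLeft hψψ hθθ hψnil
  have hNl := hN.map (Module.End.lTensorAlgHom ℚ (A ⊗[ℚ] A) A)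
  have hNr := hN.map (Module.End.rTensorAlgHom ℚ (A ⊗[ℚ] A) A)
  have hcR := commute_gsOperatorRight_lTensor hθθ hψθ
  have hcL := commute_gsOperatorLeft_rTensor hψψ hψθ
  have hEl : E.lTensor A = exp ((gsOperator A ψ θ).lTensor A) :=
    hN.map_exp (Module.End.lTensorAlgHom ℚ (A ⊗[ℚ] A) A)
  have hEr : E.rTensor A = exp ((gsOperator A ψ θ).rTensor A) :=
    hN.map_exp (Module.End.rTensorAlgHom ℚ (A ⊗[ℚ] A) A)
  have right : E (u ⊗ₜ m (E (v ⊗ₜ w))) = m.lTensor A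
      (exp (gsOperatorRight ψ θ + (gsOperator A ψ θ).lTensor A) (u ⊗ₜ (v ⊗ₜ w))) := by
    rw [exp_add_of_commute hcR hR hNl, ← hEl]
    exact LinearMap.congr_fun
      (commute_exp_left_of_commute hR hN (gsOperator_comp_lTensor_mul' hθLeibniz))
      (E.lTensor A (u ⊗ₜ (v ⊗ₜ w)))
  have left : E (m (E (u ⊗ₜ v)) ⊗ₜ w) = m.rTensor A
      (exp (gsOperatorLeft ψ θ + (gsOperator A ψ θ).rTensor A) ((u ⊗ₜ v) ⊗ₜ w)) := by
    rw [exp_add_of_commute hcL hL hNr, ← hEr]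
    exact LinearMap.congr_fun
      (commute_exp_left_of_commute hL hN (gsOperator_comp_rTensor_mul' hψLeibniz))
      (E.rTensor A ((u ⊗ₜ v) ⊗ₜ w))
  have assoc := LinearMap.congr_fun (commute_exp_left_of_commute (hcL.isNilpotent_add hL hNr)
    (hcR.isNilpotent_add hR hNl) assoc_comp_gsOperatorLeft_add) ((u ⊗ₜ v) ⊗ₜ w)
  have mul : m ∘ₗ m.lTensor A ∘ₗ (TensorProduct.assoc ℚ A A A).toLinearMap =
      m ∘ₗ m.rTensor A := by
    ext; simp [m, mul_assoc]
  simp only [LinearMap.comp_apply, LinearEquiv.coe_coe, TensorProduct.assoc_tmul] at assoc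
  rw [left, right, assoc]
  exact (LinearMap.congr_fun mul _).symm

end Star

theorem gsStar_associative_and_unital {n : ℕ} (ψ θ : Fin n → (A →ₗ[ℚ] A))
    (hψLeibniz : ∀ i, ∀ a b : A, ψ i (a * b) = a * ψ i b + ψ i a * b)
    (hθLeibniz : ∀ i, ∀ a b : A, θ i (a * b) = a * θ i b + θ i a * b)
    (hψψ : ∀ i j, ψ i ∘ₗ ψ j = ψ j ∘ₗ ψ i)
    (hθθ : ∀ i j, θ i ∘ₗ θ j = θ j ∘ₗ θ i)
    (hψθ : ∀ i j, ψ i ∘ₗ θ j = θ j ∘ₗ ψ i)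
    (hψnil : ∀ i, IsNilpotent (ψ i))
    (hθnil : ∀ i, IsNilpotent (θ i)) :
    ∃ K : ℕ, (gsOperator A ψ θ) ^ K = 0 ∧
      (∀ u v w : A, gsStar A ψ θ K (gsStar A ψ θ K u v) w
          = gsStar A ψ θ K u (gsStar A ψ θ K v w)) ∧
      (∀ u : A, gsStar A ψ θ K 1 u = u) ∧
      (∀ u : A, gsStar A ψ θ K u 1 = u) := by
  have hN := isNilpotent_gsOperator hψψ hθθ hψnil
  have hψ1 i : ψ i 1 = 0 := by simpa using hψLeibniz i 1 1
  have hθ1 i : θ i 1 = 0 := by simpa using hθLeibniz i 1 1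
  obtain ⟨K, hK⟩ := hN
  refine ⟨K, hK, fun u v w ↦ ?_, fun u ↦ ?_, fun u ↦ ?_⟩ <;> simp only [gsStar_eq_exp hK]
  · exact mul'_exp_gsOperator_assoc hψLeibniz hθLeibniz hψψ hθθ hψθ hψnil u v w
  · exact mul'_exp_gsOperator_one_tmul ⟨K, hK⟩ hψ1 u
  · exact mul'_exp_gsOperator_tmul_one ⟨K, hK⟩ hθ1 u

end
end

section
/- Let 𝒜 be an abelian category and let D be a cochain complex in 𝒜 such that every cohomology object H^n(D) is a projective object of 𝒜. Then the complex H with H^n = H^n(D) and zero differentials admits a quasi-isomorphism H → D; that is, D is quasi-isomorphic to its own cohomology regarded as a complex with zero differential. -/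
/-!
STATEMENT 13: Let `𝒜` be an abelian category and `D` a cochain complex in `𝒜` such that every
cohomology object `H^n(D)` is projective.  Then the complex `H` with `H^n = H^n(D)` and zero
differentials admits a quasi-isomorphism `H ⟶ D`.
-/

open CategoryTheory

noncomputable section

/-- The cohomology of a cochain complex `D`, regarded as a complex with zero differentials. -/
def cohomologyComplex {C : Type*} [Category C] [Abelian C]
    (D : HomologicalComplex C (ComplexShape.up ℤ)) :
    HomologicalComplex C (ComplexShape.up ℤ) where
  X n := D.homology n
  d _ _ := 0
  shape _ _ _ := rfl
  d_comp_d' := by intros; simp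

/-- A morphism from a complex with zero differentials is a quasi-isomorphism in degree `n` if it
factors there through a morphism to the cycles inducing an isomorphism onto the homology. -/
lemma quasiIsoAt_of_isIso_comp_homologyπ {C : Type*} [Category C] [Abelian C]
    {ι : Type*} {c : ComplexShape ι} {K L : HomologicalComplex C c}
    (hK : ∀ i j, K.d i j = 0) (φ : K ⟶ L) (n : ι) (s : K.X n ⟶ L.cycles n)
    (hs : s ≫ L.iCycles n = φ.f n) [IsIso (s ≫ L.homologyπ n)] : QuasiIsoAt φ n := by
  rw [quasiIsoAt_iff_isIso_homologyMap]
  have : IsIso (K.iCycles n) := K.isIso_iCycles n _ rfl (hK _ _)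
  have : IsIso (K.homologyπ n) := K.isIso_homologyπ _ n rfl (hK _ _)
  have hcycles : HomologicalComplex.cyclesMap φ n = K.iCycles n ≫ s := by
    rw [← cancel_mono (L.iCycles n), HomologicalComplex.cyclesMap_i, Category.assoc, hs]
  have : IsIso (K.homologyπ n ≫ HomologicalComplex.homologyMap φ n) := by
    rw [HomologicalComplex.homologyπ_naturality, hcycles, Category.assoc]
    infer_instance
  exact IsIso.of_isIso_comp_left (K.homologyπ n) _

theorem complex_with_projective_cohomology_is_formal
    {C : Type*} [Category C] [Abelian C]
    (D : HomologicalComplex C (ComplexShape.up ℤ))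
    (hproj : ∀ n : ℤ, Projective (D.homology n)) :
    ∃ φ : cohomologyComplex D ⟶ D, QuasiIso φ := by
  choose s hs using fun n ↦ Projective.factors (𝟙 (D.homology n)) (D.homologyπ n)
  have hd (i j : ℤ) : (cohomologyComplex D).d i j = 0 := rfl
  let φ : cohomologyComplex D ⟶ D :=
    { f := fun n ↦ s n ≫ D.iCycles n
      comm' := fun i j _ ↦ by
        rw [hd, Limits.zero_comp]
        exact (Category.assoc _ _ _).trans (by rw [D.iCycles_d]; exact Limits.comp_zero) }
  refine ⟨φ, ⟨fun n ↦ ?_⟩⟩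
  have : IsIso (s n ≫ D.homologyπ n) := by
    rw [hs]
    infer_instance
  exact @quasiIsoAt_of_isIso_comp_homologyπ _ _ _ _ _ _ _ hd φ n (s n) rfl this

end
end

section
/- Let A be a commutative K-algebra and let W ∈ W̃ℛ(A). Then for all 1 ≤ i ≤ m and 1 ≤ j ≤ n the operator λ_i g_j + g_j λ_i on W_a is multiplication by a scalar a_{ij} ∈ A independent of a, and W is generated by W_m under the λ-arrows alone, i.e., every W_a is spanned over A by elements obtained from W_m by repeated application of the maps λ_1,…,λ_m. -/
/-!
STATEMENT 15: Let `K` be a field, `m ≤ n` positive integers, `F = K^m`, `G = K^n`, and `A` a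
commutative `K`-algebra.  Let `W ∈ W̃ℛ(A)` be a representation of the doubled Beilinson
quiver with relations.  Then for all `1 ≤ i ≤ m`, `1 ≤ j ≤ n` the operator
`λ_i g_j + g_j λ_i` on `W_a` is multiplication by a scalar `a_{ij} ∈ A` independent of `a`,
and `W` is generated by `W_m` under the `λ`-arrows alone.
-/

open scoped TensorProduct

noncomputable section

/-- The data of a representation of the doubled Beilinson quiver on vertices `1, …, m`
(indexed by `v : Fin m`, vertex `a = v + 1`): `A`-modules `W_v` together with maps
`λ_i : W_v → W_u` and `g_j : W_u → W_v` for each pair of adjacent vertices `u + 1 = v`. -/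
structure DBRep (A : Type) [CommRing A] (m n : ℕ) where
  W : Fin m → Type
  [acg : ∀ v, AddCommGroup (W v)]
  [mod : ∀ v, Module A (W v)]
  lam : Fin m → ∀ u v : Fin m, (u : ℕ) + 1 = (v : ℕ) → (W v →ₗ[A] W u)
  g : Fin n → ∀ u v : Fin m, (u : ℕ) + 1 = (v : ℕ) → (W u →ₗ[A] W v)

attribute [instance] DBRep.acg DBRep.mod

namespace DBRep

variable {A : Type} [CommRing A] {m n : ℕ}

/-- The operator `λ_i g_j + g_j λ_i` on `W_v`, with undefined (out-of-quiver) composites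
silently read as `0`. -/
def phi (V : DBRep A m n) (i : Fin m) (j : Fin n) (v : Fin m) : V.W v →ₗ[A] V.W v :=
  (if h : (v : ℕ) + 1 < m then
      (V.lam i v ⟨(v : ℕ) + 1, h⟩ rfl) ∘ₗ (V.g j v ⟨(v : ℕ) + 1, h⟩ rfl)
    else 0) +
  (if h : 0 < (v : ℕ) then
      (V.g j ⟨(v : ℕ) - 1, by omega⟩ v (by simp; omega)) ∘ₗ
        (V.lam i ⟨(v : ℕ) - 1, by omega⟩ v (by simp; omega))
    else 0)

/-- The relations of the doubled Beilinson quiver: `λ_iλ_j + λ_jλ_i = 0`, `λ_i² = 0`,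
`g_ig_j + g_jg_i = 0`, `g_i² = 0`, and the centrality of `λ_ig_j + g_jλ_i` (all relations
with out-of-quiver terms silently dropped). -/
def IsRep (V : DBRep A m n) : Prop :=
  (∀ (i j : Fin m) (u v w : Fin m) (h1 : (u : ℕ) + 1 = (v : ℕ))
      (h2 : (v : ℕ) + 1 = (w : ℕ)),
      (V.lam i u v h1) ∘ₗ (V.lam j v w h2) + (V.lam j u v h1) ∘ₗ (V.lam i v w h2) = 0) ∧
  (∀ (i : Fin m) (u v w : Fin m) (h1 : (u : ℕ) + 1 = (v : ℕ))
      (h2 : (v : ℕ) + 1 = (w : ℕ)),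
      (V.lam i u v h1) ∘ₗ (V.lam i v w h2) = 0) ∧
  (∀ (i j : Fin n) (u v w : Fin m) (h1 : (u : ℕ) + 1 = (v : ℕ))
      (h2 : (v : ℕ) + 1 = (w : ℕ)),
      (V.g i v w h2) ∘ₗ (V.g j u v h1) + (V.g j v w h2) ∘ₗ (V.g i u v h1) = 0) ∧
  (∀ (i : Fin n) (u v w : Fin m) (h1 : (u : ℕ) + 1 = (v : ℕ))
      (h2 : (v : ℕ) + 1 = (w : ℕ)),
      (V.g i v w h2) ∘ₗ (V.g i u v h1) = 0) ∧
  (∀ (k i : Fin m) (j : Fin n) (u v : Fin m) (h : (u : ℕ) + 1 = (v : ℕ)),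
      (V.lam k u v h) ∘ₗ (V.phi i j v) = (V.phi i j u) ∘ₗ (V.lam k u v h)) ∧
  (∀ (l : Fin n) (i : Fin m) (j : Fin n) (u v : Fin m) (h : (u : ℕ) + 1 = (v : ℕ)),
      (V.g l u v h) ∘ₗ (V.phi i j u) = (V.phi i j v) ∘ₗ (V.g l u v h))

/-- A family of submodules is stable under the downward arrows `λ_i`. -/
def LamStable (V : DBRep A m n) (p : ∀ v, Submodule A (V.W v)) : Prop :=
  ∀ (i : Fin m) (u v : Fin m) (h : (u : ℕ) + 1 = (v : ℕ)),
    Submodule.map (V.lam i u v h) (p v) ≤ p u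

/-- A family of submodules is stable under all arrow maps (i.e. is a subrepresentation). -/
def Stable (V : DBRep A m n) (p : ∀ v, Submodule A (V.W v)) : Prop :=
  V.LamStable p ∧
  ∀ (j : Fin n) (u v : Fin m) (h : (u : ℕ) + 1 = (v : ℕ)),
    Submodule.map (V.g j u v h) (p u) ≤ p v

/-- `V` is generated by the component at the vertex `v₀`. -/
def GeneratedBy (V : DBRep A m n) (v₀ : Fin m) : Prop :=
  ∀ p : ∀ v, Submodule A (V.W v), V.Stable p → p v₀ = ⊤ → ∀ v, p v = ⊤

/-- `V` is simple: it has no subrepresentation other than `0` and `V`. -/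
def Simple (V : DBRep A m n) : Prop :=
  ∀ p : ∀ v, Submodule A (V.W v), V.Stable p →
    (∀ v, p v = ⊥) ∨ (∀ v, p v = ⊤)

end DBRep

/-- The fiberwise rank condition for finitely generated projective modules. -/
def rankEq (A : Type) [CommRing A] (P : Type) [AddCommGroup P] [Module A P] (r : ℕ) : Prop :=
  ∀ I : Ideal A, I.IsMaximal → Module.finrank (A ⧸ I) ((A ⧸ I) ⊗[A] P) = r

/-- Membership in `W̃ℛ(A)`: each `W_a` is finitely generated projective of rank
`binom(m−1, a−1)`, `W_m = A` (up to isomorphism), and `W` is generated by `W_m`. -/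
def DBRep.MemTildeR {A : Type} [CommRing A] {m n : ℕ} (V : DBRep A m n)
    (vlast : Fin m) : Prop :=
  V.IsRep ∧
  (∀ v, Module.Finite A (V.W v)) ∧ (∀ v, Module.Projective A (V.W v)) ∧
  (∀ v : Fin m, rankEq A (V.W v) ((m - 1).choose v.1)) ∧
  Nonempty (V.W vlast ≃ₗ[A] A) ∧
  V.GeneratedBy vlast


namespace DBRep

variable {A : Type} [CommRing A] {m n : ℕ}

theorem phi_apply_of_adj (V : DBRep A m n) (i : Fin m) (j : Fin n) {u v : Fin m}
    (h : (u : ℕ) + 1 = (v : ℕ)) (x : V.W v) :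
    V.phi i j v x =
      (if hv : (v : ℕ) + 1 < m then V.lam i v ⟨v + 1, hv⟩ rfl (V.g j v ⟨v + 1, hv⟩ rfl x)
        else 0) + V.g j u v h (V.lam i u v h x) := by
  obtain ⟨v, hv⟩ := v
  obtain rfl : (u : ℕ) + 1 = v := h
  simp only [phi, LinearMap.add_apply]
  congr 1
  split_ifs <;> rfl

/-- The scalar by which a central operator acts on a rank one generating component is the
scalar by which it acts everywhere. -/
theorem exists_phi_eq_smul_id {V : DBRep A m n} (hV : V.IsRep) {v₀ : Fin m}
    (e : V.W v₀ ≃ₗ[A] A) (hgen : V.GeneratedBy v₀) (i : Fin m) (j : Fin n) :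
    ∃ c : A, ∀ v : Fin m, V.phi i j v = c • (LinearMap.id : V.W v →ₗ[A] V.W v) := by
  obtain ⟨-, -, -, -, hlam, hg⟩ := hV
  refine ⟨e (V.phi i j v₀ (e.symm 1)), fun v => ?_⟩
  set c := e (V.phi i j v₀ (e.symm 1)) with hc
  have key := hgen (fun v => LinearMap.ker (V.phi i j v - c • LinearMap.id)) ⟨?_, ?_⟩ ?_ v
  · exact sub_eq_zero.mp (LinearMap.ker_eq_top.mp key)
  · rintro k u v h _ ⟨x, hx, rfl⟩
    have hx' : V.phi i j v x = c • x := by simpa [sub_eq_zero] using hx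
    have := LinearMap.congr_fun (hlam k i j u v h) x
    simp only [LinearMap.comp_apply, hx', map_smul] at this
    simp [← this]
  · rintro k u v h _ ⟨x, hx, rfl⟩
    have hx' : V.phi i j u x = c • x := by simpa [sub_eq_zero] using hx
    have := LinearMap.congr_fun (hg k i j u v h) x
    simp only [LinearMap.comp_apply, hx', map_smul] at this
    simp [← this]
  · refine LinearMap.ker_eq_top.mpr (sub_eq_zero.mpr (LinearMap.ext fun x => e.injective ?_))
    have hx : x = e x • e.symm 1 := e.injective (by simp)
    rw [hx]
    simp [← hc, mul_comm]

/-- The elements obtained from the component at `v₀` by repeatedly applying the maps `λ_i`. -/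
inductive LamReachable (V : DBRep A m n) (v₀ : Fin m) : ∀ v, V.W v → Prop
  | base (x : V.W v₀) : LamReachable V v₀ v₀ x
  | lam (i u v : Fin m) (h : (u : ℕ) + 1 = (v : ℕ)) (x : V.W v) :
      LamReachable V v₀ v x → LamReachable V v₀ u (V.lam i u v h x)

/-- The `A`-span of the elements reachable from the component at `v₀` by `λ`-arrows. -/
def lamSpan (V : DBRep A m n) (v₀ v : Fin m) : Submodule A (V.W v) :=
  Submodule.span A {x | V.LamReachable v₀ v x}

theorem lamSpan_lamStable (V : DBRep A m n) (v₀ : Fin m) : V.LamStable (V.lamSpan v₀) := by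
  intro i u v h
  rw [lamSpan, Submodule.map_span_le]
  exact fun x hx => Submodule.subset_span (.lam i u v h x hx)

theorem lamSpan_self (V : DBRep A m n) (v₀ : Fin m) : V.lamSpan v₀ v₀ = ⊤ :=
  eq_top_iff.mpr fun x _ => Submodule.subset_span (.base x)

theorem lamSpan_le {V : DBRep A m n} {v₀ : Fin m} {p : ∀ v, Submodule A (V.W v)}
    (hp : V.LamStable p) (htop : p v₀ = ⊤) (v : Fin m) : V.lamSpan v₀ v ≤ p v := by
  refine Submodule.span_le.mpr fun x hx => ?_
  induction hx with
  | base x => simp [htop]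
  | lam i u v h x _ ih => exact hp i u v h (Submodule.mem_map_of_mem ih)

/-- If the operators `λ_i g_j + g_j λ_i` act as scalars, the `λ`-span of the component at the
last vertex is a subrepresentation. -/
theorem lamSpan_stable {V : DBRep A m n} {v₀ : Fin m} (hlast : (v₀ : ℕ) = m - 1)
    (hphi : ∀ (i : Fin m) (j : Fin n), ∃ c : A, ∀ v : Fin m,
      V.phi i j v = c • (LinearMap.id : V.W v →ₗ[A] V.W v)) :
    V.Stable (V.lamSpan v₀) := by
  refine ⟨V.lamSpan_lamStable v₀, fun j u w h => ?_⟩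
  rw [lamSpan, Submodule.map_span_le]
  intro x hx
  induction hx generalizing w with
  | base x => omega
  | lam i u v h' x hx ih =>
    obtain rfl : v = w := Fin.ext (h'.symm.trans h)
    obtain ⟨c, hc⟩ := hphi i j
    have hcx := V.phi_apply_of_adj i j h x
    rw [hc, LinearMap.smul_apply, LinearMap.id_apply, ← sub_eq_iff_eq_add'] at hcx
    rw [← hcx]
    refine Submodule.sub_mem _ (Submodule.smul_mem _ c (Submodule.subset_span hx)) ?_
    split_ifs with hv
    · exact V.lamSpan_lamStable v₀ i v _ rfl (Submodule.mem_map_of_mem (ih _ rfl))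
    · exact Submodule.zero_mem _

end DBRep

theorem central_elements_act_as_scalars (K : Type) [Field K]
    (A : Type) [CommRing A] [Algebra K A] (m n : ℕ)
    (hm : 0 < m) (hmn : m ≤ n) (vlast : Fin m) (hvlast : (vlast : ℕ) = m - 1)
    (V : DBRep A m n) (hV : V.MemTildeR vlast) :
    -- the operator `λ_i g_j + g_j λ_i` acts on every `W_a` as one and the same scalar:
    (∀ (i : Fin m) (j : Fin n), ∃ c : A, ∀ v : Fin m,
      V.phi i j v = c • (LinearMap.id : V.W v →ₗ[A] V.W v)) ∧
    -- `W` is generated by `W_m` under the `λ`-arrows alone: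
    (∀ p : ∀ v, Submodule A (V.W v), V.LamStable p → p vlast = ⊤ → ∀ v, p v = ⊤) := by
  obtain ⟨hrep, -, -, -, ⟨e⟩, hgen⟩ := hV
  have hphi := DBRep.exists_phi_eq_smul_id hrep e hgen
  refine ⟨hphi, fun p hp htop v => eq_top_iff.mpr ?_⟩
  rw [← hgen _ (DBRep.lamSpan_stable hvlast hphi) (V.lamSpan_self vlast) v]
  exact DBRep.lamSpan_le hp htop v

end
end

section
/- A representation W ∈ W̃ℛ(K) is simple (i.e., has no subrepresentation other than 0 and W) if and only if W is generated by W_1, that is, the smallest subrepresentation of W containing W_1 is W itself. -/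
/-!
STATEMENT 17: Let `K` be a field and `m ≤ n` positive integers.  A representation
`W ∈ W̃ℛ(K)` of the doubled Beilinson quiver with relations is simple (has no
subrepresentation other than `0` and `W`) if and only if `W` is generated by `W_1`.
-/

open scoped TensorProduct

noncomputable section

namespace DBRep

section Words

variable {A E ι κ : Type*} [CommRing A] [AddCommGroup E] [Module A E]

/-- The span of the words of length `k` in the operators `G j`, applied to `z`. -/
def wordSpan (G : κ → E →ₗ[A] E) (z : E) : ℕ → Submodule A E
  | 0 => Submodule.span A {z}
  | k + 1 => ⨆ j, (wordSpan G z k).map (G j)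

variable {G : κ → E →ₗ[A] E} {z : E}

theorem apply_mem_wordSpan (j : κ) {k : ℕ} {y : E} (hy : y ∈ wordSpan G z k) :
    G j y ∈ wordSpan G z (k + 1) :=
  Submodule.mem_iSup_of_mem j (Submodule.mem_map_of_mem hy)

theorem wordSpan_succ_le {k : ℕ} {p : Submodule A E}
    (h : ∀ j, ∀ y ∈ wordSpan G z k, G j y ∈ p) : wordSpan G z (k + 1) ≤ p :=
  iSup_le fun j => Submodule.map_le_iff_le_comap.2 fun y hy => h j y hy

theorem annihilates_wordSpan_zero {L : E →ₗ[A] E} (hz : L z = 0) {y : E}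
    (hy : y ∈ wordSpan G z 0) : L y = 0 := by
  obtain ⟨a, rfl⟩ := Submodule.mem_span_singleton.1 hy
  rw [map_smul, hz, smul_zero]

/-- Operators that anticommute with the `G j` up to scalars and kill `z` shorten words. -/
theorem lower_mem_wordSpan {L : E →ₗ[A] E} {c : κ → A}
    (hc : ∀ j y, L (G j y) + G j (L y) = c j • y) (hz : L z = 0) (k : ℕ) :
    ∀ y ∈ wordSpan G z (k + 1), L y ∈ wordSpan G z k := by
  induction k with
  | zero =>
    refine wordSpan_succ_le (p := (wordSpan G z 0).comap L) fun j y hy => ?_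
    have h := hc j y
    rw [annihilates_wordSpan_zero hz hy, map_zero, add_zero] at h
    rw [Submodule.mem_comap, h]
    exact Submodule.smul_mem _ _ hy
  | succ k ih =>
    refine wordSpan_succ_le (p := (wordSpan G z (k + 1)).comap L) fun j y hy => ?_
    rw [Submodule.mem_comap, eq_sub_of_add_eq (hc j y)]
    exact sub_mem (Submodule.smul_mem _ _ hy) (apply_mem_wordSpan j (ih y hy))

end Words

section Total

variable {A : Type} [CommRing A] {m n : ℕ}

/-- The operator `λ_i` on the total space of `V`. -/
def totalLam (V : DBRep A m n) (i : Fin m) : (∀ v, V.W v) →ₗ[A] (∀ v, V.W v) :=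
  LinearMap.pi fun u => if h : (u : ℕ) + 1 < m then
    V.lam i u ⟨(u : ℕ) + 1, h⟩ rfl ∘ₗ LinearMap.proj (⟨(u : ℕ) + 1, h⟩ : Fin m) else 0

/-- The operator `g_j` on the total space of `V`. -/
def totalG (V : DBRep A m n) (j : Fin n) : (∀ v, V.W v) →ₗ[A] (∀ v, V.W v) :=
  LinearMap.pi fun v => if h : 0 < (v : ℕ) then
    V.g j ⟨(v : ℕ) - 1, by omega⟩ v (by simp; omega) ∘ₗ
      LinearMap.proj (⟨(v : ℕ) - 1, by omega⟩ : Fin m)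
    else 0

variable (V : DBRep A m n)

theorem totalLam_apply (i : Fin m) (x : ∀ v, V.W v) {u v : Fin m} (h : (u : ℕ) + 1 = (v : ℕ)) :
    V.totalLam i x u = V.lam i u v h (x v) := by
  obtain ⟨v, hv⟩ := v
  obtain rfl : (u : ℕ) + 1 = v := h
  simp [totalLam, hv]

theorem totalLam_apply_last (i : Fin m) (x : ∀ v, V.W v) {u : Fin m} (h : ¬ (u : ℕ) + 1 < m) :
    V.totalLam i x u = 0 := by
  simp [totalLam, h]

theorem totalG_apply (j : Fin n) (x : ∀ v, V.W v) {u v : Fin m} (h : (u : ℕ) + 1 = (v : ℕ)) :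
    V.totalG j x v = V.g j u v h (x u) := by
  obtain ⟨v, hv⟩ := v
  obtain rfl : (u : ℕ) + 1 = v := h
  simp [totalG]

theorem totalG_apply_first (j : Fin n) (x : ∀ v, V.W v) {v : Fin m} (h : ¬ 0 < (v : ℕ)) :
    V.totalG j x v = 0 := by
  simp only [totalG, LinearMap.pi_apply, dif_neg h, LinearMap.zero_apply]

theorem totalLam_single (i : Fin m) {u v : Fin m} (h : (u : ℕ) + 1 = (v : ℕ)) (y : V.W v) :
    V.totalLam i (Pi.single v y) = Pi.single u (V.lam i u v h y) := by
  funext w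
  by_cases hw : w = u
  · subst hw
    rw [totalLam_apply V i _ h, Pi.single_eq_same, Pi.single_eq_same]
  · rw [Pi.single_eq_of_ne hw]
    by_cases hm : (w : ℕ) + 1 < m
    · rw [totalLam_apply V i _ (v := ⟨(w : ℕ) + 1, hm⟩) rfl, Pi.single_eq_of_ne, map_zero]
      simp only [ne_eq, Fin.ext_iff] at hw ⊢
      omega
    · exact totalLam_apply_last V i _ hm

theorem totalLam_single_first (i : Fin m) {v : Fin m} (h : (v : ℕ) = 0) (y : V.W v) :
    V.totalLam i (Pi.single v y) = 0 := by
  funext w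
  by_cases hm : (w : ℕ) + 1 < m
  · rw [totalLam_apply V i _ (v := ⟨(w : ℕ) + 1, hm⟩) rfl, Pi.single_eq_of_ne, map_zero,
      Pi.zero_apply]
    simp only [ne_eq, Fin.ext_iff]
    omega
  · exact totalLam_apply_last V i _ hm

theorem totalG_single (j : Fin n) {u v : Fin m} (h : (u : ℕ) + 1 = (v : ℕ)) (y : V.W u) :
    V.totalG j (Pi.single u y) = Pi.single v (V.g j u v h y) := by
  funext w
  by_cases hw : w = v
  · subst hw
    rw [totalG_apply V j _ h, Pi.single_eq_same, Pi.single_eq_same]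
  · rw [Pi.single_eq_of_ne hw]
    by_cases hm : 0 < (w : ℕ)
    · rw [totalG_apply V j _ (u := ⟨(w : ℕ) - 1, by omega⟩) (by simp only; omega),
        Pi.single_eq_of_ne, map_zero]
      simp only [ne_eq, Fin.ext_iff] at hw ⊢
      omega
    · exact totalG_apply_first V j _ hm

theorem totalLam_totalG_add (i : Fin m) (j : Fin n) (x : ∀ v, V.W v) :
    V.totalLam i (V.totalG j x) + V.totalG j (V.totalLam i x) =
      fun v => V.phi i j v (x v) := by
  funext v
  rw [Pi.add_apply, phi, LinearMap.add_apply]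
  congr 1
  · by_cases hm : (v : ℕ) + 1 < m
    · rw [dif_pos hm, totalLam_apply V i _ (v := ⟨(v : ℕ) + 1, hm⟩) rfl,
        totalG_apply V j x (u := v) rfl, LinearMap.comp_apply]
    · rw [dif_neg hm, totalLam_apply_last V i _ hm, LinearMap.zero_apply]
  · by_cases hm : 0 < (v : ℕ)
    · have hv : ((⟨(v : ℕ) - 1, by omega⟩ : Fin m) : ℕ) + 1 = (v : ℕ) := by simp only; omega
      rw [dif_pos hm, totalG_apply V j _ hv, totalLam_apply V i x hv, LinearMap.comp_apply]
    · rw [dif_neg hm, totalG_apply_first V j _ hm, LinearMap.zero_apply]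

variable {V}

/-- If `V` is generated by a component isomorphic to the ground ring, then each
`λ_i g_j + g_j λ_i` acts as a scalar. -/
theorem IsRep.exists_phi_eq_smul (hV : V.IsRep) {v₀ : Fin m} (e : V.W v₀ ≃ₗ[A] A)
    (hgen : V.GeneratedBy v₀) (i : Fin m) (j : Fin n) :
    ∃ c : A, ∀ v (y : V.W v), V.phi i j v y = c • y := by
  obtain ⟨-, -, -, -, hlam, hg⟩ := hV
  set c := e (V.phi i j v₀ (e.symm 1)) with hc
  refine ⟨c, fun v y => ?_⟩
  have h := hgen (fun v => LinearMap.eqLocus (V.phi i j v) (c • LinearMap.id)) ⟨?_, ?_⟩ ?_ v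
  · exact (h ▸ Submodule.mem_top : y ∈ LinearMap.eqLocus (V.phi i j v) (c • LinearMap.id))
  · rintro k u v h _ ⟨y, hy, rfl⟩
    have hy : V.phi i j v y = c • y := hy
    have := LinearMap.congr_fun (hlam k i j u v h) y
    rw [LinearMap.comp_apply, LinearMap.comp_apply, hy, map_smul] at this
    exact this.symm
  · rintro k u v h _ ⟨y, hy, rfl⟩
    have hy : V.phi i j u y = c • y := hy
    have := LinearMap.congr_fun (hg k i j u v h) y
    rw [LinearMap.comp_apply, LinearMap.comp_apply, hy, map_smul] at this
    exact this.symm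
  · refine eq_top_iff.2 fun y _ => ?_
    change V.phi i j v₀ y = c • y
    obtain ⟨a, rfl⟩ := e.symm.surjective y
    apply e.injective
    have ha : e.symm a = a • e.symm 1 := by rw [← map_smul, smul_eq_mul, mul_one]
    rw [ha, map_smul, map_smul, ← hc, map_smul, map_smul, e.apply_symm_apply, smul_eq_mul,
      smul_eq_mul, smul_eq_mul, mul_one, mul_comm]

/-- If `V` is generated by its first component, spanned by `w`, and by its last component,
then nothing outside the first component is killed by all `λ_i`. -/
theorem eq_zero_of_totalLam_eq_zero {c : Fin m → Fin n → A}
    (hc : ∀ i j v (y : V.W v), V.phi i j v y = c i j • y)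
    {vfirst vlast : Fin m} (hvfirst : (vfirst : ℕ) = 0) (hvlast : (vlast : ℕ) = m - 1)
    (hfirst : V.GeneratedBy vfirst) (hlast : V.GeneratedBy vlast)
    {w : V.W vfirst} (hw : ∀ y : V.W vfirst, ∃ a : A, a • w = y)
    (hw_inj : ∀ a : A, a • w = w → a = 1)
    {x : ∀ v, V.W v} (hx : x vfirst = 0) (hlam : ∀ i, V.totalLam i x = 0) : x = 0 := by
  let G : Fin n → ((∀ v, V.W v) × (∀ v, V.W v)) →ₗ[A] ((∀ v, V.W v) × (∀ v, V.W v)) :=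
    fun j => (V.totalG j).prodMap (V.totalG j)
  let z : (∀ v, V.W v) × (∀ v, V.W v) := (Pi.single vfirst w, x)
  have hlower : ∀ i k, ∀ y ∈ wordSpan G z (k + 1),
      (V.totalLam i).prodMap (V.totalLam i) y ∈ wordSpan G z k := by
    intro i
    refine lower_mem_wordSpan (c := c i) (fun j y => ?_) ?_
    · refine Prod.ext ?_ ?_
      · refine (V.totalLam_totalG_add i j y.1).trans ?_
        simp only [hc]
        rfl
      · refine (V.totalLam_totalG_add i j y.2).trans ?_
        simp only [hc]
        rfl
    · exact Prod.ext (V.totalLam_single_first i hvfirst w) (hlam i)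
  have hsupp : ∀ k, ∀ y ∈ wordSpan G z k, ∀ v : Fin m, (v : ℕ) ≤ k → y.2 v = 0 := by
    intro k
    induction k with
    | zero =>
      intro y hy v hv
      obtain ⟨a, rfl⟩ := Submodule.mem_span_singleton.1 hy
      obtain rfl : v = vfirst := Fin.ext (by omega)
      change a • x v = 0
      rw [hx, smul_zero]
    | succ k ih =>
      intro y hy v hv
      refine wordSpan_succ_le (p := LinearMap.ker (LinearMap.proj v ∘ₗ LinearMap.snd A _ _))
        (fun j y hy => ?_) hy
      change V.totalG j y.2 v = 0
      by_cases hv0 : 0 < (v : ℕ)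
      · rw [V.totalG_apply j y.2 (u := ⟨(v : ℕ) - 1, by omega⟩) (by simp only; omega),
          ih y hy _ (by simp only; omega), map_zero]
      · exact V.totalG_apply_first j _ hv0
  have hfst : ∀ v : Fin m, ((wordSpan G z v).map (LinearMap.fst A _ _)).comap
      (LinearMap.single A V.W v) = ⊤ := by
    refine hfirst _ ⟨?_, ?_⟩ ?_
    · rintro i u v h _ ⟨y, ⟨q, hq, hqy⟩, rfl⟩
      rw [← h] at hq
      refine ⟨_, hlower i _ q hq, ?_⟩
      change V.totalLam i q.1 = Pi.single u _
      rw [← V.totalLam_single i h y]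
      exact congrArg _ hqy
    · rintro j u v h _ ⟨y, ⟨q, hq, hqy⟩, rfl⟩
      refine ⟨G j q, h ▸ apply_mem_wordSpan j hq, ?_⟩
      change V.totalG j q.1 = Pi.single v _
      rw [← V.totalG_single j h y]
      exact congrArg _ hqy
    · refine eq_top_iff.2 fun y _ => ?_
      obtain ⟨a, rfl⟩ := hw y
      refine ⟨a • z, ?_, ?_⟩
      · rw [hvfirst]
        exact Submodule.smul_mem _ _ (Submodule.mem_span_singleton_self z)
      · exact (Pi.single_smul vfirst a w).symm
  have hpair : ∀ v : Fin m, (wordSpan G z v).comap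
      (LinearMap.inl A _ _ ∘ₗ LinearMap.single A V.W v) = ⊤ := by
    refine hlast _ ⟨?_, ?_⟩ ?_
    · rintro i u v h _ ⟨y, hy, rfl⟩
      have hy : (Pi.single v y, 0) ∈ wordSpan G z v := hy
      rw [← h] at hy
      have := hlower i _ _ hy
      rw [LinearMap.prodMap_apply, V.totalLam_single i h y, map_zero] at this
      exact this
    · rintro j u v h _ ⟨y, hy, rfl⟩
      have hy : (Pi.single u y, 0) ∈ wordSpan G z u := hy
      have := apply_mem_wordSpan j hy
      rw [LinearMap.prodMap_apply, V.totalG_single j h y, map_zero, h] at this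
      exact this
    · refine eq_top_iff.2 fun y _ => ?_
      obtain ⟨q, hq, hqy⟩ : y ∈ ((wordSpan G z vlast).map (LinearMap.fst A _ _)).comap
        (LinearMap.single A V.W vlast) := hfst vlast ▸ Submodule.mem_top
      have hq2 : q = (Pi.single vlast y, 0) :=
        Prod.ext hqy (funext fun v => hsupp _ q hq v (by omega))
      rw [hq2] at hq
      exact hq
  have hmem : w ∈ (wordSpan G z vfirst).comap
      (LinearMap.inl A _ _ ∘ₗ LinearMap.single A V.W vfirst) :=
    hpair vfirst ▸ Submodule.mem_top
  rw [hvfirst] at hmem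
  obtain ⟨a, ha⟩ := Submodule.mem_span_singleton.1 hmem
  have ha1 : a • w = w := by
    have := congrFun (congrArg Prod.fst ha) vfirst
    simpa [z] using this
  have ha2 : a • x = 0 := congrArg Prod.snd ha
  rwa [hw_inj a ha1, one_smul] at ha2

end Total

end DBRep

theorem simple_iff_generated_by_W1 (K : Type) [Field K] (m n : ℕ)
    (hm : 0 < m) (hmn : m ≤ n)
    (vfirst : Fin m) (hvfirst : (vfirst : ℕ) = 0)
    (vlast : Fin m) (hvlast : (vlast : ℕ) = m - 1)
    (V : DBRep K m n) (hV : V.IsRep)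
    (hfd : ∀ v, FiniteDimensional K (V.W v))
    (hdim : ∀ v : Fin m, Module.finrank K (V.W v) = (m - 1).choose v.1)
    (hWm : Nonempty (V.W vlast ≃ₗ[K] K))
    (hgen : V.GeneratedBy vlast) :
    V.Simple ↔ V.GeneratedBy vfirst := by
  have hd : Module.finrank K (V.W vfirst) = 1 := by rw [hdim, hvfirst, Nat.choose_zero_right]
  constructor
  · intro hs p hp htop
    refine (hs p hp).resolve_left fun hbot => ?_
    have hsub : (⊥ : Submodule K (V.W vfirst)) = ⊤ := (hbot vfirst).symm.trans htop
    have h := finrank_top K (V.W vfirst)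
    rw [← hsub, finrank_bot, hd] at h
    exact zero_ne_one h
  · intro hfirst p hp
    obtain ⟨e⟩ := hWm
    choose c hc using hV.exists_phi_eq_smul e hgen
    obtain ⟨w, hw0, hw⟩ := finrank_eq_one_iff'.1 hd
    have hsocle : ∀ {v : Fin m}, v ≠ vfirst → ∀ y : V.W v,
        (∀ i u h, V.lam i u v h y = 0) → y = 0 := by
      intro v hv y hy
      have hv0 : (v : ℕ) ≠ 0 := fun h => hv (Fin.ext (h.trans hvfirst.symm))
      refine Pi.single_eq_zero_iff.1 (DBRep.eq_zero_of_totalLam_eq_zero hc hvfirst hvlast hfirst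
        hgen hw (fun a ha => ?_) (Pi.single_eq_of_ne hv.symm y) fun i => ?_)
      · exact smul_left_injective K hw0 (ha.trans (one_smul K w).symm)
      · have h : ((⟨(v : ℕ) - 1, by omega⟩ : Fin m) : ℕ) + 1 = (v : ℕ) := by simp only; omega
        rw [V.totalLam_single i h y, hy, Pi.single_zero]
    by_cases hbot : p vfirst = ⊥
    · left
      suffices ∀ k, ∀ v : Fin m, (v : ℕ) = k → p v = ⊥ from fun v => this v v rfl
      intro k
      induction k with
      | zero =>
        intro v hv
        obtain rfl : v = vfirst := Fin.ext (hv.trans hvfirst.symm)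
        exact hbot
      | succ k ih =>
        intro v hv
        refine (Submodule.eq_bot_iff _).2 fun y hy => hsocle ?_ y fun i u h => ?_
        · rintro rfl
          omega
        · have hmem := hp.1 i u v h (Submodule.mem_map_of_mem hy)
          rwa [ih u (by omega), Submodule.mem_bot] at hmem
    · right
      refine hfirst p hp (eq_top_iff.2 fun y _ => ?_)
      obtain ⟨b, hb, hb0⟩ := (Submodule.ne_bot_iff _).1 hbot
      obtain ⟨a, rfl⟩ := (finrank_eq_one_iff_of_nonzero' b hb0).1 hd y
      exact Submodule.smul_mem _ a hb

end
end

section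
/- Let P be a K-vector space of dimension m−1, α : P → F an injective linear map, and β : P^∨ → G^∨ a linear map, and let W_{αβ} ∈ W̃ℛ(K) be the associated representation. Then W_{αβ} is a simple representation if and only if β is injective. -/
/-!
STATEMENT 18: Let `K` be a field, `m ≤ n` positive integers, `F = K^m`, `G = K^n`.  Let `P` be
a `K`-vector space of dimension `m−1`, `α : P → F` an injective linear map and
`β : P^∨ → G^∨` a linear map, and let `W_{αβ}` be the associated representation of the doubled
Beilinson quiver ( `(W_{αβ})_a = Λ^{m−a} P^∨`, `λ ∈ F^∨` acting by exterior multiplication by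
`α^∨(λ)`, `g ∈ G` acting by contraction against `β^∨(g)` ).  Then `W_{αβ}` is simple if and
only if `β` is injective.

"Being the representation `W_{αβ}`" is expressed, as in STATEMENT 16, by a family of linear
equivalences `ψ_v : W_v ≃ Λ^{m−1−v} P^∨` carrying the arrows to the operators above.
-/

open scoped TensorProduct

noncomputable section

/-- Left contraction on the exterior algebra `Λ P^∨` with a functional on `P^∨`. -/
def ctrP (A : Type) [CommRing A] (P : Type) [AddCommGroup P] [Module A P]
    (f : Module.Dual A (Module.Dual A P)) :
    ExteriorAlgebra A (Module.Dual A P) →ₗ[A] ExteriorAlgebra A (Module.Dual A P) :=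
  CliffordAlgebra.contractLeft (Q := (0 : QuadraticForm A (Module.Dual A P))) f

/-- `ψ` exhibits the representation `V` as the representation `W_{αβ}`. -/
def IsStandardFormAB {A : Type} [CommRing A] {m n : ℕ} (V : DBRep A m n)
    (P : Type) [AddCommGroup P] [Module A P]
    (α : P →ₗ[A] (Fin m → A)) (β : Module.Dual A P →ₗ[A] (Fin n → A))
    (ψ : ∀ v : Fin m, V.W v ≃ₗ[A] ⋀[A]^(m - 1 - v.1) (Module.Dual A P)) : Prop :=
  (∀ (i : Fin m) (u v : Fin m) (h : (u : ℕ) + 1 = (v : ℕ)) (x : V.W v),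
    ((ψ u (V.lam i u v h x) : ⋀[A]^(m - 1 - u.1) (Module.Dual A P)) :
        ExteriorAlgebra A (Module.Dual A P))
      = ExteriorAlgebra.ι A (α.dualMap (LinearMap.proj i)) *
          ((ψ v x : ⋀[A]^(m - 1 - v.1) (Module.Dual A P)) :
            ExteriorAlgebra A (Module.Dual A P))) ∧
  (∀ (j : Fin n) (u v : Fin m) (h : (u : ℕ) + 1 = (v : ℕ)) (x : V.W u),
    ((ψ v (V.g j u v h x) : ⋀[A]^(m - 1 - v.1) (Module.Dual A P)) :
        ExteriorAlgebra A (Module.Dual A P))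
      = ctrP A P ((LinearMap.proj j) ∘ₗ β)
          ((ψ u x : ⋀[A]^(m - 1 - u.1) (Module.Dual A P)) :
            ExteriorAlgebra A (Module.Dual A P)))

namespace ExteriorAlgebra

open CliffordAlgebra (contractLeft)

section CommRing

variable {R M : Type*} [CommRing R] [AddCommGroup M] [Module R M]

theorem contractLeft_ι_mul (f : Module.Dual R M) (a : M) (x : ExteriorAlgebra R M) :
    contractLeft (Q := (0 : QuadraticForm R M)) f (ι R a * x) =
      f a • x - ι R a * contractLeft (Q := (0 : QuadraticForm R M)) f x :=
  CliffordAlgebra.contractLeft_ι_mul f a x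

theorem ι_mul_ι_mul_swap (a b : M) (x : ExteriorAlgebra R M) :
    ι R a * (ι R b * x) = -(ι R b * (ι R a * x)) := by
  rw [← mul_assoc, ← mul_assoc, ← neg_mul, eq_neg_of_add_eq_zero_left (ι_add_mul_swap a b)]

theorem ι_mul_contractLeft_eq_zero {f : Module.Dual R M} {a : M} {x : ExteriorAlgebra R M}
    (hfa : f a = 0) (hx : ι R a * x = 0) :
    ι R a * contractLeft (Q := (0 : QuadraticForm R M)) f x = 0 := by
  have h := contractLeft_ι_mul f a x
  rwa [hx, map_zero, hfa, zero_smul, zero_sub, eq_comm, neg_eq_zero] at h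

/-- An element of the ideal generated by part of a basis which is killed by all contractions
is zero. -/
theorem eq_zero_of_contractLeft_eq_zero_of_sum {I : Type*} (b : Module.Basis I R M)
    (s : Finset I) (y : I → ExteriorAlgebra R M)
    (h : ∀ f : Module.Dual R M,
      contractLeft (Q := (0 : QuadraticForm R M)) f (∑ i ∈ s, ι R (b i) * y i) = 0) :
    ∑ i ∈ s, ι R (b i) * y i = 0 := by
  classical
  induction s using Finset.induction_on generalizing y with
  | empty => simp
  | insert k s hk ih =>
    have key : ∑ i ∈ insert k s, ι R (b i) * y i =
        ∑ i ∈ s, ι R (b i) *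
          contractLeft (Q := (0 : QuadraticForm R M)) (b.coord k) (ι R (b k) * y i) := by
      have h1 := contractLeft_ι_mul (b.coord k) (b k) (∑ i ∈ insert k s, ι R (b i) * y i)
      rw [h, mul_zero, sub_zero, b.coord_apply, b.repr_self, Finsupp.single_eq_same,
        one_smul] at h1
      rw [← h1, Finset.sum_insert hk, mul_add, ← mul_assoc, ι_sq_zero, zero_mul, zero_add,
        Finset.mul_sum, map_sum]
      refine Finset.sum_congr rfl fun i hi => ?_
      have hik : i ≠ k := fun e => hk (e ▸ hi)
      rw [ι_mul_ι_mul_swap, map_neg, contractLeft_ι_mul, b.coord_apply, b.repr_self,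
        Finsupp.single_eq_of_ne hik.symm, zero_smul, zero_sub, neg_neg]
    rw [key]
    exact ih _ (by rwa [← key])

theorem exists_sum_ι_mul_of_mem_range_mul {I : Type*} [Fintype I] (b : Module.Basis I R M)
    {N : Submodule R (ExteriorAlgebra R M)} {x : ExteriorAlgebra R M}
    (hx : x ∈ LinearMap.range (ι R : M →ₗ[R] ExteriorAlgebra R M) * N) :
    ∃ y : I → ExteriorAlgebra R M, x = ∑ i, ι R (b i) * y i := by
  induction hx using Submodule.mul_induction_on' with
  | mem_mul_mem a ha z _ =>
    obtain ⟨a, rfl⟩ := ha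
    refine ⟨fun i => b.repr a i • z, ?_⟩
    conv_lhs => rw [← b.sum_repr a, map_sum, Finset.sum_mul]
    simp
  | add x _ x' _ hx hx' =>
    obtain ⟨y, rfl⟩ := hx
    obtain ⟨y', rfl⟩ := hx'
    exact ⟨y + y', by simp [mul_add, Finset.sum_add_distrib]⟩

end CommRing

/-- A nonzero element of positive degree in the exterior algebra of a finite-dimensional space
has a nonzero contraction. -/
theorem eq_zero_of_forall_contractLeft_eq_zero {K M : Type*} [Field K] [AddCommGroup M]
    [Module K M] [FiniteDimensional K M] {k : ℕ} {x : ExteriorAlgebra K M}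
    (hx : x ∈ ⋀[K]^(k + 1) M)
    (h : ∀ f : Module.Dual K M, contractLeft (Q := (0 : QuadraticForm K M)) f x = 0) :
    x = 0 := by
  rw [exteriorPower, pow_succ'] at hx
  obtain ⟨y, rfl⟩ := exists_sum_ι_mul_of_mem_range_mul (Module.finBasis K M) hx
  exact eq_zero_of_contractLeft_eq_zero_of_sum _ _ _ h

end ExteriorAlgebra

/-- Every functional on `K^n` is a combination of the coordinate projections. -/
theorem dual_pi_eq_sum_proj {K : Type*} [CommRing K] {n : ℕ} (φ : Module.Dual K (Fin n → K)) :
    φ = ∑ j, φ (fun i => if j = i then 1 else 0) • (LinearMap.proj j : (Fin n → K) →ₗ[K] K) := by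
  refine LinearMap.ext fun x => ?_
  rw [LinearMap.pi_apply_eq_sum_univ φ x]
  simp [mul_comm]

section StandardForm

variable {K : Type} [Field K] {m n : ℕ} {P : Type} [AddCommGroup P] [Module K P]
  {α : P →ₗ[K] (Fin m → K)} {β : Module.Dual K P →ₗ[K] (Fin n → K)}
  {V : DBRep K m n} {ψ : ∀ v : Fin m, V.W v ≃ₗ[K] ⋀[K]^(m - 1 - v.1) (Module.Dual K P)}

namespace IsStandardFormAB

theorem exists_g_ne_zero [FiniteDimensional K P] (hstd : IsStandardFormAB V P α β ψ) (hβ : Function.Injective β)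
    {u v : Fin m} (h : (u : ℕ) + 1 = v) {x : V.W u} (hx : x ≠ 0) :
    ∃ j, V.g j u v h x ≠ 0 := by
  by_contra! hg
  refine hx ((ψ u).map_eq_zero_iff.mp (Subtype.ext ?_))
  have hk : m - 1 - (u : ℕ) = (m - 1 - (v : ℕ)) + 1 := by have := v.2; omega
  refine ExteriorAlgebra.eq_zero_of_forall_contractLeft_eq_zero (k := m - 1 - v) ?_ fun f => ?_
  · rw [← hk]
    exact (ψ u x).2
  obtain ⟨φ, rfl⟩ := LinearMap.dualMap_surjective_of_injective hβ f
  rw [dual_pi_eq_sum_proj φ]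
  simp only [map_sum, map_smul, LinearMap.sum_apply, LinearMap.smul_apply]
  refine Finset.sum_eq_zero fun j _ => ?_
  have hj := hstd.2 j u v h x
  rw [hg j, map_zero] at hj
  exact smul_eq_zero_of_right _ hj.symm

theorem exists_ne_zero_last [FiniteDimensional K P] (hstd : IsStandardFormAB V P α β ψ) (hβ : Function.Injective β)
    {p : ∀ v, Submodule K (V.W v)} (hp : V.Stable p) (k : ℕ) (u : Fin m)
    (hk : (u : ℕ) + k = m - 1) (x : V.W u) (hxp : x ∈ p u) (hx : x ≠ 0)
    (w : Fin m) (hw : (w : ℕ) = m - 1) : ∃ y ∈ p w, y ≠ 0 := by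
  induction k generalizing u with
  | zero =>
    obtain rfl : u = w := Fin.ext (by omega)
    exact ⟨x, hxp, hx⟩
  | succ k ih =>
    have h : (u : ℕ) + 1 = (⟨u + 1, by omega⟩ : Fin m) := rfl
    obtain ⟨j, hj⟩ := hstd.exists_g_ne_zero hβ h hx
    exact ih _ (by simp only; omega) _ (hp.2 j u _ h (Submodule.mem_map_of_mem hxp)) hj

theorem eq_top_last {w : Fin m} (hw : (w : ℕ) = m - 1)
    (ψ : V.W w ≃ₗ[K] ⋀[K]^(m - 1 - w.1) (Module.Dual K P)) {q : Submodule K (V.W w)}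
    {y : V.W w} (hyq : y ∈ q) (hy : y ≠ 0) : q = ⊤ := by
  have hscalar (t : ExteriorAlgebra K (Module.Dual K P))
      (ht : t ∈ ⋀[K]^(m - 1 - w.1) (Module.Dual K P)) : ∃ c, algebraMap K _ c = t := by
    rwa [ExteriorAlgebra.exteriorPower, hw, Nat.sub_self, pow_zero, Submodule.mem_one] at ht
  rw [eq_top_iff]
  intro z _
  obtain ⟨c, hc⟩ := hscalar _ (ψ y).2
  obtain ⟨d, hd⟩ := hscalar _ (ψ z).2
  have hc0 : c ≠ 0 := by
    rintro rfl
    rw [map_zero] at hc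
    exact hy (ψ.map_eq_zero_iff.mp (Subtype.ext hc.symm))
  have hz : z = (d / c) • y := by
    refine ψ.injective (Subtype.ext ?_)
    rw [map_smul, Submodule.coe_smul, ← hc, ← hd, Algebra.smul_def, ← map_mul,
      div_mul_cancel₀ _ hc0]
  exact hz ▸ q.smul_mem _ hyq

theorem eq_top_of_succ (hstd : IsStandardFormAB V P α β ψ) (hα : Function.Injective α)
    {p : ∀ v, Submodule K (V.W v)} (hp : V.LamStable p) {u v : Fin m} (h : (u : ℕ) + 1 = v)
    (hv : p v = ⊤) : p u = ⊤ := by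
  have hk : m - 1 - (u : ℕ) = (m - 1 - (v : ℕ)) + 1 := by have := v.2; omega
  have hle : ⋀[K]^(m - 1 - u.1) (Module.Dual K P) ≤
      ((p u).map (ψ u).toLinearMap).map (Submodule.subtype _) := by
    conv_lhs => rw [ExteriorAlgebra.exteriorPower, hk, pow_succ']
    rw [Submodule.mul_le]
    rintro _ ⟨d, rfl⟩ y hy
    obtain ⟨φ, rfl⟩ := LinearMap.dualMap_surjective_of_injective hα d
    rw [dual_pi_eq_sum_proj φ]
    simp only [map_sum, map_smul, Finset.sum_mul, smul_mul_assoc]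
    refine Submodule.sum_mem _ fun i _ => Submodule.smul_mem _ _ ?_
    have hi := hstd.1 i u v h ((ψ v).symm ⟨y, hy⟩)
    rw [LinearEquiv.apply_symm_apply] at hi
    rw [← hi]
    exact Submodule.mem_map_of_mem (Submodule.mem_map_of_mem
      (hp i u v h (Submodule.mem_map_of_mem (hv ▸ Submodule.mem_top))))
  rw [eq_top_iff]
  intro x _
  obtain ⟨_, ⟨x', hx', rfl⟩, hxx'⟩ := hle (ψ u x).2
  rwa [← (ψ u).injective (Subtype.ext hxx')]

theorem eq_top_of_last (hstd : IsStandardFormAB V P α β ψ) (hα : Function.Injective α)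
    {p : ∀ v, Submodule K (V.W v)} (hp : V.LamStable p) {w : Fin m} (hw : (w : ℕ) = m - 1)
    (hpw : p w = ⊤) (k : ℕ) (u : Fin m) (hk : (u : ℕ) + k = m - 1) : p u = ⊤ := by
  induction k generalizing u with
  | zero =>
    obtain rfl : u = w := Fin.ext (by omega)
    exact hpw
  | succ k ih =>
    exact hstd.eq_top_of_succ hα hp (v := ⟨u + 1, by omega⟩) rfl (ih _ (by simp only; omega))

theorem simple [FiniteDimensional K P] (hstd : IsStandardFormAB V P α β ψ) (hm : 0 < m) (hα : Function.Injective α)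
    (hβ : Function.Injective β) : V.Simple := by
  intro p hp
  by_contra! hcon
  obtain ⟨⟨u, hu⟩, v, hv⟩ := hcon
  obtain ⟨x, hxp, hx⟩ := (Submodule.ne_bot_iff _).mp hu
  have hw : ((⟨m - 1, by omega⟩ : Fin m) : ℕ) = m - 1 := rfl
  obtain ⟨y, hyp, hy⟩ := hstd.exists_ne_zero_last hβ hp (m - 1 - u) u (by omega) x hxp hx _ hw
  exact hv (hstd.eq_top_of_last hα hp.1 hw (eq_top_last hw (ψ _) hyp hy) (m - 1 - v) v
    (by omega))

/-- The elements of `V` killed by exterior multiplication by `d ∈ ker β` form a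
subrepresentation. -/
theorem stable_ker_mul (hstd : IsStandardFormAB V P α β ψ) {d : Module.Dual K P}
    (hd : β d = 0) :
    V.Stable fun v => LinearMap.ker (LinearMap.mulLeft K (ExteriorAlgebra.ι K d) ∘ₗ
      Submodule.subtype _ ∘ₗ (ψ v).toLinearMap) := by
  constructor
  · rintro i u v h _ ⟨x, hx, rfl⟩
    change ExteriorAlgebra.ι K d * (ψ v x : ExteriorAlgebra K _) = 0 at hx
    change ExteriorAlgebra.ι K d * (ψ u _ : ExteriorAlgebra K _) = 0
    rw [hstd.1 i u v h x, ExteriorAlgebra.ι_mul_ι_mul_swap, hx, mul_zero, neg_zero]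
  · rintro j u v h _ ⟨x, hx, rfl⟩
    change ExteriorAlgebra.ι K d * (ψ u x : ExteriorAlgebra K _) = 0 at hx
    change ExteriorAlgebra.ι K d * (ψ v _ : ExteriorAlgebra K _) = 0
    rw [hstd.2 j u v h x]
    exact ExteriorAlgebra.ι_mul_contractLeft_eq_zero (by simp [hd]) hx

theorem injective_of_simple [FiniteDimensional K P] (hstd : IsStandardFormAB V P α β ψ)
    (hdimP : Module.finrank K P = m - 1) (hV : V.Simple) : Function.Injective β := by
  rw [injective_iff_map_eq_zero]
  intro d hd
  by_contra hd0
  have : Nontrivial P := by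
    by_contra hP
    rw [not_nontrivial_iff_subsingleton] at hP
    exact hd0 (Subsingleton.elim _ _)
  have hpos : 0 < Module.finrank K P := Module.finrank_pos
  have hι : ExteriorAlgebra.ι K d ≠ 0 := (ExteriorAlgebra.ι_eq_zero_iff d).not.mpr hd0
  rcases hV _ (hstd.stable_ker_mul hd) with hbot | htop
  · let u : Fin m := ⟨m - 2, by omega⟩
    have hmem : ExteriorAlgebra.ι K d ∈ ⋀[K]^(m - 1 - u.1) (Module.Dual K P) := by
      rw [ExteriorAlgebra.exteriorPower, show m - 1 - u.1 = 1 by simp only [u]; omega, pow_one]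
      exact ⟨d, rfl⟩
    have hker := LinearMap.ker_eq_bot'.mp (hbot u) ((ψ u).symm ⟨_, hmem⟩)
      (by simp)
    rw [LinearEquiv.map_eq_zero_iff] at hker
    exact hι (congrArg Subtype.val hker)
  · let w : Fin m := ⟨m - 1, by omega⟩
    have hmem : (1 : ExteriorAlgebra K (Module.Dual K P)) ∈
        ⋀[K]^(m - 1 - w.1) (Module.Dual K P) := by
      rw [ExteriorAlgebra.exteriorPower, show m - 1 - w.1 = 0 by simp [w], pow_zero]
      exact Submodule.one_le.mp le_rfl
    have hker := LinearMap.congr_fun (LinearMap.ker_eq_top.mp (htop w)) ((ψ w).symm ⟨_, hmem⟩)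
    simp at hker
    exact hd0 hker

end IsStandardFormAB

end StandardForm

theorem Wab_simple_iff_beta_injective (K : Type) [Field K] (m n : ℕ)
    (hm : 0 < m) (hmn : m ≤ n)
    (P : Type) [AddCommGroup P] [Module K P] [FiniteDimensional K P]
    (hdimP : Module.finrank K P = m - 1)
    (α : P →ₗ[K] (Fin m → K)) (hα : Function.Injective α)
    (β : Module.Dual K P →ₗ[K] (Fin n → K))
    (V : DBRep K m n) (hV : V.IsRep)
    (ψ : ∀ v : Fin m, V.W v ≃ₗ[K] ⋀[K]^(m - 1 - v.1) (Module.Dual K P))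
    (hstd : IsStandardFormAB V P α β ψ) :
    V.Simple ↔ Function.Injective β :=
  ⟨hstd.injective_of_simple hdimP, hstd.simple hm hα⟩

end
end
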